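/- arXiv:2507.10390 — 11 statements merged into one kernel-verified Lean document; each statement's English description precedes it below -/
import Mathlib

section
/- Fix integers m>0, n>0 and define F(x,y):=(m+x)/√((m+x)²+(n+y)²) + x/√(x²+y²) − m/√(m²+n²) for (x,y)∈ℝ² with (x,y)≠(0,0) and (x,y)≠(−m,−n). Then for every y>0 there exists a unique x∈ℝ such that F(x,y)=0. Consequently the portion of the resonant set R_k with positive second coordinate is the graph of a function φ₊:(0,∞)→ℝ. -/
/-- The function whose zero set characterizes the resonant set `R_k` away from `0` and `-k`. -/
noncomputable def Ffun (m n : ℤ) (x y : ℝ) : ℝ :=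
  ((m : ℝ) + x) / Real.sqrt (((m : ℝ) + x) ^ 2 + ((n : ℝ) + y) ^ 2)
    + x / Real.sqrt (x ^ 2 + y ^ 2)
    - (m : ℝ) / Real.sqrt ((m : ℝ) ^ 2 + (n : ℝ) ^ 2)

theorem aux_pos {a b c : ℝ} (hc : 0 < c) (ha : 0 ≤ a) (h : a < b) :
    a / Real.sqrt (a ^ 2 + c ^ 2) < b / Real.sqrt (b ^ 2 + c ^ 2) := by
  have hA : 0 < a ^ 2 + c ^ 2 := by positivity
  have hB : 0 < b ^ 2 + c ^ 2 := by positivity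
  have hb : 0 < b := lt_of_le_of_lt ha h
  rw [div_lt_div_iff₀ (Real.sqrt_pos.2 hA) (Real.sqrt_pos.2 hB)]
  refine lt_of_pow_lt_pow_left₀ 2 (by positivity) ?_
  rw [mul_pow, mul_pow, Real.sq_sqrt hA.le, Real.sq_sqrt hB.le]
  have h1 : a ^ 2 < b ^ 2 := pow_lt_pow_left₀ h ha two_ne_zero
  have h2 : 0 < c ^ 2 := by positivity
  nlinarith

theorem aux_mono {c : ℝ} (hc : 0 < c) :
    StrictMono (fun t : ℝ => t / Real.sqrt (t ^ 2 + c ^ 2)) := by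
  intro a b h
  show a / Real.sqrt (a ^ 2 + c ^ 2) < b / Real.sqrt (b ^ 2 + c ^ 2)
  rcases le_or_gt 0 a with ha | ha
  · exact aux_pos hc ha h
  rcases le_or_gt 0 b with hb | hb
  · have hA : 0 < a ^ 2 + c ^ 2 := by positivity
    exact lt_of_lt_of_le (div_neg_of_neg_of_pos ha (Real.sqrt_pos.2 hA)) (by positivity)
  · have := aux_pos (a := -b) (b := -a) hc (by linarith) (by linarith)
    simp only [neg_sq, neg_div] at this
    linarith

/-- for every `y > 0` there is a unique `x` with `F(x,y) = 0`; hence the part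
of the resonant set with positive second coordinate is the graph of a function `φ₊`. -/
theorem resonant_upper_graph (m n : ℤ) (hm : 0 < m) (hn : 0 < n) :
    ∀ y : ℝ, 0 < y → ∃! x : ℝ, Ffun m n x y = 0 := by
  intro y hy
  have hm' : (0 : ℝ) < m := by exact_mod_cast hm
  have hn' : (0 : ℝ) < n := by exact_mod_cast hn
  have hny : (0 : ℝ) < n + y := by positivity
  have hmono : StrictMono (fun x : ℝ => Ffun m n x y) := by
    intro a b h
    have h1 := aux_mono hny (show (m : ℝ) + a < m + b by linarith)
    have h2 := aux_mono hy h
    simp only [Ffun] at h1 h2 ⊢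
    linarith
  have hcont : Continuous (fun x : ℝ => Ffun m n x y) := by
    have h1 : ∀ x : ℝ, Real.sqrt (((m : ℝ) + x) ^ 2 + ((n : ℝ) + y) ^ 2) ≠ 0 :=
      fun x => (Real.sqrt_pos.2 (by positivity)).ne'
    have h2 : ∀ x : ℝ, Real.sqrt (x ^ 2 + y ^ 2) ≠ 0 :=
      fun x => (Real.sqrt_pos.2 (by positivity)).ne'
    unfold Ffun
    refine ((Continuous.div ?_ ?_ h1).add (Continuous.div ?_ ?_ h2)).sub ?_ <;> fun_prop
  have hlow : Ffun m n (-m) y ≤ 0 := by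
    have h1 : 0 < (m : ℝ) / Real.sqrt ((m : ℝ) ^ 2 + y ^ 2) := by positivity
    have h2 : 0 < (m : ℝ) / Real.sqrt ((m : ℝ) ^ 2 + (n : ℝ) ^ 2) := by positivity
    simp only [Ffun, add_neg_cancel, zero_div, neg_sq, neg_div]
    linarith
  have hhigh : 0 ≤ Ffun m n (y / n * m) y := by
    have e : (y / n * m) ^ 2 + y ^ 2 = (y / n) ^ 2 * ((m : ℝ) ^ 2 + (n : ℝ) ^ 2) := by
      field_simp
    have hp : 0 < y / n := by positivity
    have h1 : 0 ≤ ((m : ℝ) + y / n * m) /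
        Real.sqrt (((m : ℝ) + y / n * m) ^ 2 + ((n : ℝ) + y) ^ 2) := by positivity
    unfold Ffun
    rw [e, Real.sqrt_mul (by positivity), Real.sqrt_sq hp.le, mul_div_mul_left _ _ hp.ne']
    linarith
  obtain ⟨x, hx⟩ := mem_range_of_exists_le_of_exists_ge hcont ⟨_, hlow⟩ ⟨_, hhigh⟩
  exact ⟨x, hx, fun z hz => hmono.injective (hz.trans hx.symm)⟩
end

section
/- Fix integers m>0, n>0 and define F(x,y):=(m+x)/√((m+x)²+(n+y)²) + x/√(x²+y²) − m/√(m²+n²) for (x,y)∈ℝ² with (x,y)≠(0,0) and (x,y)≠(−m,−n). Then for every y<0 with y≠−n there exists a unique x∈ℝ such that F(x,y)=0. Consequently the portion of the resonant set R_k with second coordinate in (−∞,0)∖{−n} is the graph of a function φ₋. -/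
theorem g_mono (c : ℝ) (hc : c ≠ 0) : StrictMono (fun t : ℝ => t / Real.sqrt (t ^ 2 + c ^ 2)) := by
  intro a b hab
  have hc2 : 0 < c ^ 2 := by positivity
  have hA : 0 < Real.sqrt (a ^ 2 + c ^ 2) := Real.sqrt_pos.2 (by positivity)
  have hB : 0 < Real.sqrt (b ^ 2 + c ^ 2) := Real.sqrt_pos.2 (by positivity)
  have hA2 : Real.sqrt (a ^ 2 + c ^ 2) ^ 2 = a ^ 2 + c ^ 2 := Real.sq_sqrt (by positivity)
  have hB2 : Real.sqrt (b ^ 2 + c ^ 2) ^ 2 = b ^ 2 + c ^ 2 := Real.sq_sqrt (by positivity)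
  show a / Real.sqrt (a ^ 2 + c ^ 2) < b / Real.sqrt (b ^ 2 + c ^ 2)
  have ha : |a| ≤ Real.sqrt (a ^ 2 + c ^ 2) := Real.abs_le_sqrt (by linarith)
  have hb : |b| ≤ Real.sqrt (b ^ 2 + c ^ 2) := Real.abs_le_sqrt (by linarith)
  set A := Real.sqrt (a ^ 2 + c ^ 2)
  set B := Real.sqrt (b ^ 2 + c ^ 2)
  have hab' : a * b ≤ A * B := by
    calc a * b ≤ |a * b| := le_abs_self _
      _ = |a| * |b| := abs_mul a b
      _ ≤ A * B := mul_le_mul ha hb (abs_nonneg _) hA.le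
  rw [div_lt_div_iff₀ hA hB]
  have key : (b * A - a * B) * (A + B) = (b - a) * (c ^ 2 + (A * B - a * b)) := by
    linear_combination b * hA2 - a * hB2
  have hpos : 0 < (b * A - a * B) * (A + B) := by
    rw [key]
    exact mul_pos (by linarith) (by linarith)
  have := pos_of_mul_pos_left hpos (by linarith)
  linarith

theorem g_cont (c : ℝ) (hc : c ≠ 0) : Continuous (fun t : ℝ => t / Real.sqrt (t ^ 2 + c ^ 2)) := by
  refine Continuous.div continuous_id (by fun_prop) fun t => ?_
  have hc2 : 0 < c ^ 2 := by positivity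
  exact (Real.sqrt_pos.2 (by positivity)).ne'

/-- for every `y < 0` with `y ≠ -n` there is a unique `x` with `F(x,y) = 0`;
hence the part of the resonant set with second coordinate in `(-∞,0) ∖ {-n}` is the graph
of a function `φ₋`. -/
theorem resonant_lower_graph (m n : ℤ) (hm : 0 < m) (hn : 0 < n) :
    ∀ y : ℝ, y < 0 → y ≠ -(n : ℝ) → ∃! x : ℝ, Ffun m n x y = 0 := by
  intro y hy hyn
  have hm' : (0 : ℝ) < m := by exact_mod_cast hm
  have hn' : (0 : ℝ) < n := by exact_mod_cast hn
  have hc : (n : ℝ) + y ≠ 0 := fun h => hyn (by linarith)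
  have m1 := g_mono ((n : ℝ) + y) hc
  have m2 := g_mono y hy.ne
  have hmono : StrictMono (fun x => Ffun m n x y) := by
    intro a b hab
    have h1 := m1 (show (m : ℝ) + a < m + b by linarith)
    have h2 := m2 hab
    simp only [Ffun] at h1 h2 ⊢
    linarith
  have hcont : Continuous (fun x => Ffun m n x y) := by
    have h1 := (g_cont ((n : ℝ) + y) hc).comp (continuous_const_add (m : ℝ))
    have h2 := g_cont y hy.ne
    exact (h1.add h2).sub continuous_const
  have hmpos : 0 < (m : ℝ) / Real.sqrt ((m : ℝ) ^ 2 + (n : ℝ) ^ 2) := by positivity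
  have hlo : Ffun m n (-m) y ≤ 0 := by
    have h2 := m2 (show -(m : ℝ) < 0 by linarith)
    simp only [zero_div] at h2
    simp only [Ffun, add_neg_cancel, zero_div]
    linarith
  have hx0 : 0 < m * (-y / n) := by
    have : 0 < -y := by linarith
    positivity
  have hhi : 0 ≤ Ffun m n (m * (-y / n)) y := by
    have h1 := m1 (show (0 : ℝ) < m + m * (-y / n) by linarith)
    simp only [zero_div] at h1
    have hr : 0 < -y / n := div_pos (by linarith) hn'
    have hs : Real.sqrt ((m * (-y / n)) ^ 2 + y ^ 2)
        = Real.sqrt ((m : ℝ) ^ 2 + (n : ℝ) ^ 2) * (-y / n) := by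
      rw [show ((m : ℝ) * (-y / n)) ^ 2 + y ^ 2
        = ((m : ℝ) ^ 2 + (n : ℝ) ^ 2) * (-y / n) ^ 2 by field_simp]
      rw [Real.sqrt_mul (by positivity), Real.sqrt_sq hr.le]
    simp only [Ffun]
    rw [hs, mul_div_mul_right _ _ hr.ne']
    linarith
  obtain ⟨x, -, hx⟩ := intermediate_value_Icc (show -(m : ℝ) ≤ m * (-y / n) by linarith)
    hcont.continuousOn ⟨hlo, hhi⟩
  exact ⟨x, hx, fun z hz => hmono.injective (hz.trans hx.symm)⟩
end

section
/- Fix integers m>0, n>0 and define F(x,y):=(m+x)/√((m+x)²+(n+y)²) + x/√(x²+y²) − m/√(m²+n²) for (x,y)∈ℝ² with (x,y)≠(0,0) and (x,y)≠(−m,−n). If φ:(0,∞)→ℝ satisfies F(φ(y),y)=0 for all y>0, then φ is strictly increasing: for all 0<y₁<y₂ one has φ(y₁)<φ(y₂). -/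
theorem g_eq (p q : ℝ) (hq : 0 < q) :
    p / Real.sqrt (p ^ 2 + q ^ 2) = Real.sin (Real.arctan (p / q)) := by
  rw [Real.sin_arctan]
  have h : p ^ 2 + q ^ 2 = q ^ 2 * (1 + (p / q) ^ 2) := by field_simp; ring
  rw [h, Real.sqrt_mul (by positivity), Real.sqrt_sq hq.le, div_div]

theorem g_lt (p q p' q' : ℝ) (hq : 0 < q) (hq' : 0 < q') (h : p * q' < p' * q) :
    p / Real.sqrt (p ^ 2 + q ^ 2) < p' / Real.sqrt (p' ^ 2 + q' ^ 2) := by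
  rw [g_eq p q hq, g_eq p' q' hq']
  apply Real.sin_lt_sin_of_lt_of_le_pi_div_two (Real.neg_pi_div_two_lt_arctan _).le
    (Real.arctan_lt_pi_div_two _).le
  apply Real.arctan_strictMono
  rwa [div_lt_div_iff₀ hq hq']

/-- the upper branch `φ₊` of the resonant set is strictly increasing. -/
theorem phi_plus_strict_mono (m n : ℤ) (hm : 0 < m) (hn : 0 < n)
    (φ : ℝ → ℝ) (hφ : ∀ y : ℝ, 0 < y → Ffun m n (φ y) y = 0) :
    ∀ y₁ y₂ : ℝ, 0 < y₁ → y₁ < y₂ → φ y₁ < φ y₂ := by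
  have hm' : (0 : ℝ) < m := by exact_mod_cast hm
  have hn' : (0 : ℝ) < n := by exact_mod_cast hn
  have pos : ∀ y : ℝ, 0 < y → 0 < φ y := by
    intro y hy
    by_contra hx
    push Not at hx
    have h := hφ y hy
    unfold Ffun at h
    have h1 : φ y / Real.sqrt (φ y ^ 2 + y ^ 2) ≤ 0 :=
      div_nonpos_of_nonpos_of_nonneg hx (Real.sqrt_nonneg _)
    have h2 := g_lt (m + φ y) (n + y) m n (by positivity) hn'
      (by nlinarith [mul_pos hm' hy, mul_nonneg (neg_nonneg.2 hx) hn'.le])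
    linarith
  intro y₁ y₂ h1 h12
  have h2 := h1.trans h12
  by_contra hle
  push Not at hle
  have p1 := pos y₁ h1
  have p2 := pos y₂ h2
  have e1 := hφ y₁ h1
  have e2 := hφ y₂ h2
  unfold Ffun at e1 e2
  have a := g_lt (φ y₂) y₂ (φ y₁) y₁ h2 h1
    (mul_lt_mul' hle h12 h1.le p1)
  have b := g_lt (m + φ y₂) (n + y₂) (m + φ y₁) (n + y₁) (by positivity) (by positivity)
    (mul_lt_mul' (by linarith) (by linarith) (by positivity) (by positivity))
  linarith
end

section
/- Fix integers m>0, n>0 and define F(x,y):=(m+x)/√((m+x)²+(n+y)²) + x/√(x²+y²) − m/√(m²+n²) for (x,y)∈ℝ² with (x,y)≠(0,0) and (x,y)≠(−m,−n). If φ:(0,∞)→ℝ satisfies F(φ(y),y)=0 for all y>0, then lim_{y→0⁺} φ(y)/y² = m·n/(m²+n²)^{3/2}. -/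
lemma aux_mono_s7 {b t s : ℝ} (hb : 0 < b) (h : t < s) :
    t / Real.sqrt (t ^ 2 + b ^ 2) < s / Real.sqrt (s ^ 2 + b ^ 2) := by
  have hA : 0 < Real.sqrt (t ^ 2 + b ^ 2) := Real.sqrt_pos.2 (by positivity)
  have hB : 0 < Real.sqrt (s ^ 2 + b ^ 2) := Real.sqrt_pos.2 (by positivity)
  have hA2 : Real.sqrt (t ^ 2 + b ^ 2) ^ 2 = t ^ 2 + b ^ 2 := Real.sq_sqrt (by positivity)
  have hB2 : Real.sqrt (s ^ 2 + b ^ 2) ^ 2 = s ^ 2 + b ^ 2 := Real.sq_sqrt (by positivity)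
  have hAt : |t| < Real.sqrt (t ^ 2 + b ^ 2) := by
    apply Real.lt_sqrt_of_sq_lt
    rw [sq_abs]
    have : 0 < b ^ 2 := by positivity
    linarith
  have hBs : |s| < Real.sqrt (s ^ 2 + b ^ 2) := by
    apply Real.lt_sqrt_of_sq_lt
    rw [sq_abs]
    have : 0 < b ^ 2 := by positivity
    linarith
  rw [div_lt_div_iff₀ hA hB]
  generalize Real.sqrt (t ^ 2 + b ^ 2) = A at *
  generalize Real.sqrt (s ^ 2 + b ^ 2) = B at *
  rw [abs_lt] at hAt hBs
  have h1 : 0 < (s - t) * ((A + B - (s + t)) * (A + B + (s + t))) := by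
    apply mul_pos (by linarith)
    apply mul_pos <;> linarith
  have h2 : (s - t) * ((A + B - (s + t)) * (A + B + (s + t)))
      = (2 * (s * A - t * B)) * (A + B) := by
    linear_combination (-s - t) * (hA2 - hB2)
  rw [h2] at h1
  have := pos_of_mul_pos_left h1 (by linarith)
  linarith

lemma F_mono (m n : ℤ) (hn : 0 < n) {y : ℝ} (hy : 0 < y) : StrictMono (fun x => Ffun m n x y) := by
  intro t s h
  have hn' : (0 : ℝ) < n := by exact_mod_cast hn
  have h1 := aux_mono_s7 hy h
  have h2 := aux_mono_s7 (b := (n : ℝ) + y) (by linarith) (add_lt_add_right h (m : ℝ))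
  simp only [Ffun]
  linarith

lemma F_tendsto (m n : ℤ) (hm : 0 < m) (c : ℝ) :
    Filter.Tendsto (fun y : ℝ => Ffun m n (c * y ^ 2) y / y) (nhdsWithin 0 (Set.Ioi 0))
      (nhds (c - (m : ℝ) * (n : ℝ) / Real.sqrt ((m : ℝ) ^ 2 + (n : ℝ) ^ 2) ^ 3)) := by
  have hm' : (0 : ℝ) < m := by exact_mod_cast hm
  have hK : 0 < Real.sqrt ((m : ℝ) ^ 2 + (n : ℝ) ^ 2) := Real.sqrt_pos.2 (by positivity)
  have hK2 : Real.sqrt ((m : ℝ) ^ 2 + (n : ℝ) ^ 2) ^ 2 = (m : ℝ) ^ 2 + (n : ℝ) ^ 2 :=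
    Real.sq_sqrt (by positivity)
  have d1 : HasDerivAt (fun y : ℝ => (m : ℝ) + c * y ^ 2) 0 0 := by
    simpa using (((hasDerivAt_id (0 : ℝ)).pow 2).const_mul c).const_add (m : ℝ)
  have d2 : HasDerivAt (fun y : ℝ => (n : ℝ) + y) 1 0 := (hasDerivAt_id (0 : ℝ)).const_add (n : ℝ)
  have d3 : HasDerivAt (fun y : ℝ => ((m : ℝ) + c * y ^ 2) ^ 2 + ((n : ℝ) + y) ^ 2) (2 * n) 0 := by
    simpa using (d1.fun_pow 2).fun_add (d2.fun_pow 2)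
  have d4 := d3.sqrt (by simp; positivity)
  have d5 := d1.fun_div d4 (by simpa using hK.ne')
  have d6 : HasDerivAt (fun y : ℝ => c ^ 2 * y ^ 2 + 1) 0 0 := by
    simpa using (((hasDerivAt_id (0 : ℝ)).pow 2).const_mul (c ^ 2)).add_const (1 : ℝ)
  have d7 := d6.sqrt (by simp)
  have d8 : HasDerivAt (fun y : ℝ => c * y) c 0 := by
    simpa using (hasDerivAt_id (0 : ℝ)).const_mul c
  have d9 := d5.fun_add (d8.fun_div d7 (by simp))
  have d10 := (hasDerivAt_iff_tendsto_slope.1 d9).mono_left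
    (nhdsWithin_mono 0 (t := {0}ᶜ) (s := Set.Ioi (0 : ℝ)) (fun x hx => ne_of_gt hx))
  have e : ∀ K : ℝ, K = Real.sqrt ((m : ℝ) ^ 2 + (n : ℝ) ^ 2) →
      c - (m : ℝ) * n / K ^ 3 = (0 * K - m * (2 * n / (2 * K))) / K ^ 2 + c := by
    intro K hh
    have : K ≠ 0 := by rw [hh]; exact hK.ne'
    field_simp
    ring
  rw [e _ rfl]
  refine (Filter.Tendsto.congr' ?_ d10).trans (le_of_eq ?_)
  · filter_upwards [self_mem_nhdsWithin] with y hy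
    have hy : 0 < y := hy
    have hs : Real.sqrt ((c * y ^ 2) ^ 2 + y ^ 2) = y * Real.sqrt (c ^ 2 * y ^ 2 + 1) := by
      rw [show (c * y ^ 2) ^ 2 + y ^ 2 = y ^ 2 * (c ^ 2 * y ^ 2 + 1) by ring,
        Real.sqrt_mul (by positivity), Real.sqrt_sq hy.le]
    have hq : 0 < Real.sqrt (c ^ 2 * y ^ 2 + 1) := Real.sqrt_pos.2 (by positivity)
    have hr : c * y ^ 2 / (y * Real.sqrt (c ^ 2 * y ^ 2 + 1))
        = c * y / Real.sqrt (c ^ 2 * y ^ 2 + 1) := by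
      field_simp
    simp only [Ffun, slope_def_field, hs, hr]
    simp
  · simp

theorem phi_plus_asymptotic_zero (m n : ℤ) (hm : 0 < m) (hn : 0 < n)
    (φ : ℝ → ℝ) (hφ : ∀ y : ℝ, 0 < y → Ffun m n (φ y) y = 0) :
    Filter.Tendsto (fun y : ℝ => φ y / y ^ 2) (nhdsWithin 0 (Set.Ioi 0))
      (nhds ((m : ℝ) * (n : ℝ) / Real.sqrt ((m : ℝ) ^ 2 + (n : ℝ) ^ 2) ^ 3)) := by
  rw [tendsto_order]
  constructor
  · intro c hc
    filter_upwards [self_mem_nhdsWithin,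
      (F_tendsto m n hm c).eventually_lt_const (sub_neg.2 hc)] with y hy h
    have hy : 0 < y := hy
    rw [lt_div_iff₀ (by positivity)]
    apply (F_mono m n hn hy).lt_iff_lt.1
    simp only [hφ y hy]
    rwa [div_lt_iff₀ hy, zero_mul] at h
  · intro c hc
    filter_upwards [self_mem_nhdsWithin,
      (F_tendsto m n hm c).eventually_const_lt (sub_pos.2 hc)] with y hy h
    have hy : 0 < y := hy
    rw [div_lt_iff₀ (by positivity)]
    apply (F_mono m n hn hy).lt_iff_lt.1
    simp only [hφ y hy]
    rwa [lt_div_iff₀ hy, zero_mul] at h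
end

section
/- Fix integers m>0, n>0 and define F(x,y):=(m+x)/√((m+x)²+(n+y)²) + x/√(x²+y²) − m/√(m²+n²) for (x,y)∈ℝ² with (x,y)≠(0,0) and (x,y)≠(−m,−n). If φ:(0,∞)→ℝ satisfies F(φ(y),y)=0 for all y>0, then lim_{y→+∞} [ φ(y) − (m/√(3m²+4n²))·(y + n/2) + m/2 ] = 0. -/
noncomputable def sfun (t : ℝ) : ℝ := t / Real.sqrt (1 + t ^ 2)

lemma sfun_hasDerivAt (t : ℝ) :
    HasDerivAt sfun (1 / ((1 + t ^ 2) * Real.sqrt (1 + t ^ 2))) t := by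
  have h0 : 0 < 1 + t ^ 2 := by positivity
  have hs : 0 < Real.sqrt (1 + t ^ 2) := Real.sqrt_pos.mpr h0
  have h1 : HasDerivAt (fun t : ℝ => 1 + t ^ 2) (2 * t) t := by
    simpa using ((hasDerivAt_id t).pow 2).const_add 1
  have h2 := (hasDerivAt_id t).div (h1.sqrt h0.ne') hs.ne'
  have hsq := Real.sq_sqrt h0.le
  refine h2.congr_deriv ?_
  simp only [id]
  generalize Real.sqrt (1 + t ^ 2) = r at *
  rw [← hsq]
  field_simp
  linarith

lemma sfun_strictMono : StrictMono sfun := by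
  apply strictMono_of_deriv_pos
  intro t
  rw [(sfun_hasDerivAt t).deriv]
  positivity

lemma sfun_div (u v : ℝ) (hv : 0 < v) :
    u / Real.sqrt (u ^ 2 + v ^ 2) = sfun (u / v) := by
  unfold sfun
  have : u ^ 2 + v ^ 2 = v ^ 2 * (1 + (u / v) ^ 2) := by field_simp; ring
  rw [this, Real.sqrt_mul (by positivity), Real.sqrt_sq hv.le]
  have hs : 0 < Real.sqrt (1 + (u / v) ^ 2) := Real.sqrt_pos.mpr (by positivity)
  field_simp

lemma Ffun_eq (m n : ℤ) (hn : 0 < n) (x y : ℝ) (hy : 0 < y) :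
    Ffun m n x y = sfun ((m + x) / (n + y)) + sfun (x / y)
      - (m : ℝ) / Real.sqrt ((m : ℝ) ^ 2 + (n : ℝ) ^ 2) := by
  have hn' : (0 : ℝ) < n := by exact_mod_cast hn
  unfold Ffun
  rw [sfun_div _ _ (by positivity : (0 : ℝ) < n + y), sfun_div _ _ hy]

lemma Ffun_mono (m n : ℤ) (hn : 0 < n) (x x' y : ℝ) (hy : 0 < y) (h : x ≤ x') :
    Ffun m n x y ≤ Ffun m n x' y := by
  have hn' : (0 : ℝ) < n := by exact_mod_cast hn
  rw [Ffun_eq m n hn x y hy, Ffun_eq m n hn x' y hy]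
  have h1 : sfun ((m + x) / (n + y)) ≤ sfun ((m + x') / (n + y)) :=
    sfun_strictMono.monotone (by gcongr)
  have h2 : sfun (x / y) ≤ sfun (x' / y) := sfun_strictMono.monotone (by gcongr)
  linarith

lemma sfun_a (m n : ℤ) (hm : 0 < m) :
    2 * sfun ((m : ℝ) / Real.sqrt (3 * (m : ℝ) ^ 2 + 4 * (n : ℝ) ^ 2))
      = (m : ℝ) / Real.sqrt ((m : ℝ) ^ 2 + (n : ℝ) ^ 2) := by
  have hm' : (0 : ℝ) < m := by exact_mod_cast hm
  have hp : (0 : ℝ) < 3 * (m : ℝ) ^ 2 + 4 * (n : ℝ) ^ 2 := by positivity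
  rw [← sfun_div _ _ (Real.sqrt_pos.mpr hp), Real.sq_sqrt hp.le]
  have : (m : ℝ) ^ 2 + (3 * (m : ℝ) ^ 2 + 4 * (n : ℝ) ^ 2)
      = 2 ^ 2 * ((m : ℝ) ^ 2 + (n : ℝ) ^ 2) := by ring
  rw [this, Real.sqrt_mul (by positivity), Real.sqrt_sq (by norm_num)]
  have : 0 < Real.sqrt ((m : ℝ) ^ 2 + (n : ℝ) ^ 2) := Real.sqrt_pos.mpr (by positivity)
  field_simp

lemma sfun_lim (a b c : ℝ) :
    Filter.Tendsto (fun y : ℝ => y * (sfun (a + b / (c + y)) - sfun a)) Filter.atTop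
      (nhds (b * (1 / ((1 + a ^ 2) * Real.sqrt (1 + a ^ 2))))) := by
  have hd : Filter.Tendsto (fun y : ℝ => y * (b / (c + y))) Filter.atTop (nhds b) := by
    have h1 : Filter.Tendsto (fun y : ℝ => c + y) Filter.atTop Filter.atTop :=
      Filter.tendsto_atTop_add_const_left _ _ Filter.tendsto_id
    have h2 : Filter.Tendsto (fun y : ℝ => b - b * c / (c + y)) Filter.atTop (nhds (b - 0)) :=
      tendsto_const_nhds.sub (h1.const_div_atTop _)
    rw [sub_zero] at h2
    refine h2.congr' ?_
    filter_upwards [h1.eventually_gt_atTop 0] with y hy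
    field_simp
    ring
  have h0 : Filter.Tendsto (fun y : ℝ => b / (c + y)) Filter.atTop (nhds 0) :=
    (Filter.tendsto_atTop_add_const_left _ _ Filter.tendsto_id).const_div_atTop _
  have := (hasFDerivWithinAt_univ.2 (sfun_hasDerivAt a).hasFDerivAt).lim (c := fun y : ℝ => y)
    h0 (.of_forall fun _ => Set.mem_univ _) hd
  simpa using this

lemma F_lim (m n : ℤ) (hm : 0 < m) (hn : 0 < n) (ε a : ℝ)
    (ha : a = (m : ℝ) / Real.sqrt (3 * (m : ℝ) ^ 2 + 4 * (n : ℝ) ^ 2)) :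
    Filter.Tendsto (fun y : ℝ => y * Ffun m n (a * (y + (n : ℝ) / 2) - (m : ℝ) / 2 + ε) y)
      Filter.atTop (nhds (2 * ε * (1 / ((1 + a ^ 2) * Real.sqrt (1 + a ^ 2))))) := by
  have hn' : (0 : ℝ) < n := by exact_mod_cast hn
  have h := (sfun_lim a (m / 2 - a * n / 2 + ε) n).add (sfun_lim a (a * n / 2 - m / 2 + ε) 0)
  rw [← add_mul] at h
  have e : (m / 2 - a * n / 2 + ε : ℝ) + (a * n / 2 - m / 2 + ε) = 2 * ε := by ring
  rw [e] at h
  refine h.congr' ?_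
  filter_upwards [Filter.eventually_gt_atTop 0] with y hy
  have hny : (0 : ℝ) < n + y := by positivity
  rw [Ffun_eq m n hn _ y hy, ← sfun_a m n hm, ← ha]
  have e1 : (m + (a * (y + (n : ℝ) / 2) - (m : ℝ) / 2 + ε)) / (n + y)
      = a + (m / 2 - a * n / 2 + ε) / (n + y) := by field_simp; ring
  have e2 : (a * (y + (n : ℝ) / 2) - (m : ℝ) / 2 + ε) / y
      = a + (a * n / 2 - m / 2 + ε) / (0 + y) := by rw [zero_add]; field_simp; ring
  rw [e1, e2]
  ring

/-- high-Floquet asymptotics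
`φ₊(y) = (m/√(3m²+4n²))·(y + n/2) − m/2 + o(1)` as `y → +∞`. -/
theorem phi_plus_asymptotic_infty (m n : ℤ) (hm : 0 < m) (hn : 0 < n)
    (φ : ℝ → ℝ) (hφ : ∀ y : ℝ, 0 < y → Ffun m n (φ y) y = 0) :
    Filter.Tendsto
      (fun y : ℝ => φ y
        - ((m : ℝ) / Real.sqrt (3 * (m : ℝ) ^ 2 + 4 * (n : ℝ) ^ 2)) * (y + (n : ℝ) / 2)
        + (m : ℝ) / 2)
      Filter.atTop (nhds 0) := by
  obtain ⟨a, ha⟩ : ∃ a, a = (m : ℝ) / Real.sqrt (3 * (m : ℝ) ^ 2 + 4 * (n : ℝ) ^ 2) := ⟨_, rfl⟩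
  rw [← ha]
  have hD : 0 < 1 / ((1 + a ^ 2) * Real.sqrt (1 + a ^ 2)) := by positivity
  rw [Metric.tendsto_nhds]
  intro ε hε
  have h1 := (F_lim m n hm hn ε a ha).eventually_const_lt (u := 0) (by positivity)
  have h2 := (F_lim m n hm hn (-ε) a ha).eventually_lt_const (u := 0) (by nlinarith)
  filter_upwards [h1, h2, Filter.eventually_gt_atTop 0] with y h1 h2 hy
  have h0 := hφ y hy
  rw [Real.dist_eq, sub_zero, abs_lt]
  constructor
  · by_contra! hc
    have := Ffun_mono m n hn (φ y) (a * (y + (n : ℝ) / 2) - (m : ℝ) / 2 + -ε) y hy (by linarith)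
    nlinarith
  · by_contra! hc
    have := Ffun_mono m n hn (a * (y + (n : ℝ) / 2) - (m : ℝ) / 2 + ε) (φ y) y hy (by linarith)
    nlinarith
end

section
/- Fix integers m>0, n>0 with n²>3m², and define F(x,y):=(m+x)/√((m+x)²+(n+y)²) + x/√(x²+y²) − m/√(m²+n²) for (x,y)∈ℝ² with (x,y)≠(0,0) and (x,y)≠(−m,−n). Let 0<δ<n and let φ be a function defined for y<0 with 0<|y+n|<δ satisfying F(φ(y),y)=0 for all such y. Then lim_{y→−n} (φ(y)+m)/|n+y| = 2m/√(n²−3m²). -/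
lemma aux_S (x b : ℝ) (hb : b ≠ 0) :
    x / Real.sqrt (x ^ 2 + b ^ 2) = Real.sin (Real.arctan (x / |b|)) := by
  have hb' : 0 < |b| := abs_pos.mpr hb
  rw [Real.sin_arctan]
  have h1 : 1 + (x / |b|) ^ 2 = (x ^ 2 + b ^ 2) / |b| ^ 2 := by
    field_simp
    rw [sq_abs]
    ring
  rw [h1, Real.sqrt_div (by positivity), Real.sqrt_sq hb'.le]
  have : 0 < Real.sqrt (x ^ 2 + b ^ 2) := Real.sqrt_pos.mpr (by positivity)
  field_simp

lemma aux_mono_s9 : StrictMono (fun t : ℝ => Real.sin (Real.arctan t)) := by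
  intro s t hst
  exact Real.strictMonoOn_sin ⟨(Real.neg_pi_div_two_lt_arctan s).le, (Real.arctan_lt_pi_div_two s).le⟩
    ⟨(Real.neg_pi_div_two_lt_arctan t).le, (Real.arctan_lt_pi_div_two t).le⟩
    (Real.arctan_strictMono hst)

lemma aux_star (m n : ℝ) (hm : 0 < m) (h3 : 3 * m ^ 2 < n ^ 2) :
    Real.sin (Real.arctan (2 * m / Real.sqrt (n ^ 2 - 3 * m ^ 2)))
      = 2 * (m / Real.sqrt (m ^ 2 + n ^ 2)) := by
  have hp : 0 < Real.sqrt (n ^ 2 - 3 * m ^ 2) := Real.sqrt_pos.mpr (by linarith)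
  have h := aux_S (2 * m) (Real.sqrt (n ^ 2 - 3 * m ^ 2)) hp.ne'
  rw [abs_of_pos hp, Real.sq_sqrt (by linarith)] at h
  rw [← h, show (2 * m) ^ 2 + (n ^ 2 - 3 * m ^ 2) = m ^ 2 + n ^ 2 by ring]
  ring

/-- in the regime `n² > 3m²`, the lower branch `φ₋` has a Lipschitz corner
at `y = -n` with slope `a* = 2m/√(n²−3m²)`:
`lim_{y→−n} (φ(y)+m)/|n+y| = 2m/√(n²−3m²)`. -/
theorem phi_minus_corner (m n : ℤ) (hm : 0 < m) (hn : 0 < n)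
    (h3 : 3 * (m : ℝ) ^ 2 < (n : ℝ) ^ 2)
    (δ : ℝ) (hδ0 : 0 < δ) (hδn : δ < (n : ℝ))
    (φ : ℝ → ℝ)
    (hφ : ∀ y : ℝ, y < 0 → 0 < |y + (n : ℝ)| → |y + (n : ℝ)| < δ → Ffun m n (φ y) y = 0) :
    Filter.Tendsto (fun y : ℝ => (φ y + (m : ℝ)) / |(n : ℝ) + y|)
      (nhdsWithin (-(n : ℝ)) {y : ℝ | y ≠ -(n : ℝ)})
      (nhds (2 * (m : ℝ) / Real.sqrt ((n : ℝ) ^ 2 - 3 * (m : ℝ) ^ 2))) := by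
  have hm' : (0 : ℝ) < m := by exact_mod_cast hm
  have hn' : (0 : ℝ) < n := by exact_mod_cast hn
  have hstar := aux_star m n hm' h3
  set c : ℝ := (m : ℝ) / Real.sqrt ((m : ℝ) ^ 2 + (n : ℝ) ^ 2) with hc
  set A : ℝ := 2 * (m : ℝ) / Real.sqrt ((n : ℝ) ^ 2 - 3 * (m : ℝ) ^ 2) with hA
  set l := nhdsWithin (-(n : ℝ)) {y : ℝ | y ≠ -(n : ℝ)} with hl
  -- near `-n`, the equation in terms of `sin ∘ arctan`
  have hev : ∀ᶠ y in l, 0 < |(n : ℝ) + y| ∧ 0 < |y| ∧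
      Real.sin (Real.arctan ((φ y + m) / |(n : ℝ) + y|)) +
        Real.sin (Real.arctan (φ y / |y|)) - c = 0 := by
    have h1 : ∀ᶠ y in l, y ≠ -(n : ℝ) := eventually_mem_nhdsWithin
    have h2 : ∀ᶠ y in l, |y + (n : ℝ)| < δ := by
      apply Filter.Eventually.filter_mono nhdsWithin_le_nhds
      have := Metric.ball_mem_nhds (-(n : ℝ)) hδ0
      filter_upwards [this] with y hy
      simpa [Real.dist_eq] using hy
    filter_upwards [h1, h2] with y hy1 hy2
    have hne : (n : ℝ) + y ≠ 0 := fun h => hy1 (by linarith)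
    have hy0 : y < 0 := by
      have := (abs_lt.mp hy2).2
      linarith
    refine ⟨abs_pos.mpr hne, abs_pos.mpr hy0.ne, ?_⟩
    have h := hφ y hy0 (by rw [add_comm]; exact abs_pos.mpr hne) hy2
    unfold Ffun at h
    rw [aux_S _ _ hne, aux_S _ _ hy0.ne, add_comm (m : ℝ) (φ y)] at h
    exact h
  have hlim : ∀ a : ℝ, Filter.Tendsto (fun y : ℝ => Real.sin (Real.arctan a) +
      Real.sin (Real.arctan ((a * |(n : ℝ) + y| - m) / |y|)) - c) l
      (nhds (Real.sin (Real.arctan a) - Real.sin (Real.arctan A))) := by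
    intro a
    have hcont : ContinuousAt (fun y : ℝ => Real.sin (Real.arctan a) +
      Real.sin (Real.arctan ((a * |(n : ℝ) + y| - m) / |y|)) - c) (-(n : ℝ)) := by
      have h0 : |(-(n : ℝ))| ≠ 0 := by simpa using hn'.ne'
      have hd : ContinuousAt (fun y : ℝ => (a * |(n : ℝ) + y| - m) / |y|) (-(n : ℝ)) := by
        apply ContinuousAt.div _ _ h0 <;> fun_prop
      have h4 : ContinuousAt (fun y : ℝ => Real.sin (Real.arctan
          ((a * |(n : ℝ) + y| - m) / |y|))) (-(n : ℝ)) :=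
        (Real.continuous_sin.comp Real.continuous_arctan).continuousAt.comp hd
      exact (continuousAt_const.add h4).sub continuousAt_const
    have hval : Real.sin (Real.arctan a) +
        Real.sin (Real.arctan ((a * |(n : ℝ) + -(n : ℝ)| - m) / |(-(n : ℝ))|)) - c
        = Real.sin (Real.arctan a) - Real.sin (Real.arctan A) := by
      have h5 := aux_S (-(m : ℝ)) n hn'.ne'
      rw [add_neg_cancel, abs_zero, mul_zero, zero_sub, abs_neg, ← h5, hstar, neg_sq, neg_div, ← hc]
      ring
    have := hcont.tendsto
    rw [hval] at this
    exact this.mono_left nhdsWithin_le_nhds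
  rw [tendsto_order]
  constructor
  · intro a ha
    have hneg : Real.sin (Real.arctan a) - Real.sin (Real.arctan A) < 0 := sub_neg.mpr (aux_mono_s9 ha)
    filter_upwards [hev, (hlim a).eventually_lt_const hneg] with y ⟨hy1, hy2, hy3⟩ hy4
    by_contra hcon
    push Not at hcon
    have e1 := aux_mono_s9.monotone hcon
    have e2 : φ y / |y| ≤ (a * |(n : ℝ) + y| - m) / |y| := by
      rw [div_le_iff₀ hy1] at hcon
      gcongr
      linarith
    have e3 := aux_mono_s9.monotone e2
    linarith
  · intro a ha
    have hpos : 0 < Real.sin (Real.arctan a) - Real.sin (Real.arctan A) := sub_pos.mpr (aux_mono_s9 ha)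
    filter_upwards [hev, (hlim a).eventually_const_lt hpos] with y ⟨hy1, hy2, hy3⟩ hy4
    by_contra hcon
    push Not at hcon
    have e1 := aux_mono_s9.monotone hcon
    have e2 : (a * |(n : ℝ) + y| - m) / |y| ≤ φ y / |y| := by
      rw [le_div_iff₀ hy1] at hcon
      gcongr
      linarith
    have e3 := aux_mono_s9.monotone e2
    linarith
end

section
/- Let N>0, fix integers m>0, n>0, set k:=(m,n)∈ℝ², c:=(N·m/‖k‖³)·k, and for ℓ∈ℤ, σ∈{+,−}, μ∈ℝ² let w^σ_ℓ(μ):=c·(ℓk+μ)+σ·Ω(ℓk+μ). Then: (a) for every μ∈ℝ² and every ℓ∈ℤ, w⁻_ℓ(μ) − w⁻_1(μ) = (ℓ−1)·Ω(k) − Ω(ℓk+μ) + Ω(k+μ); (b) for every μ∈R_k and every ℓ∈ℤ, w⁺_ℓ(μ) − w⁺_0(μ) = (ℓ−1)·Ω(k) + Ω(ℓk+μ) + Ω(k+μ); (c) there exists ℓ₀∈ℕ such that for every μ∈R_k and every ℓ∈ℤ with |ℓ|≥ℓ₀ one has |w⁺_ℓ(μ) − w⁺_0(μ)| ≥ 1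 and |w⁻_ℓ(μ) − w⁻_1(μ)| ≥ 1. -/
open Classical in
/-- Internal-wave dispersion relation `Ω(v) = N v₁ / ‖v‖` for `v ≠ 0`, `Ω(0) = 0`. -/
noncomputable def Om (N : ℝ) (v : ℝ × ℝ) : ℝ :=
  if v = 0 then 0 else N * v.1 / Real.sqrt (v.1 ^ 2 + v.2 ^ 2)

/-- The resonant set `R_k = {0} ∪ {μ ≠ 0 : Ω(k) − Ω(k+μ) = Ω(μ)}` for `k = (m,n)`. -/
noncomputable def Rk (N : ℝ) (m n : ℤ) : Set (ℝ × ℝ) :=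
  {0} ∪ {μ | μ ≠ 0 ∧ Om N ((m : ℝ), (n : ℝ)) - Om N (((m : ℝ), (n : ℝ)) + μ) = Om N μ}

/-- The frequencies `w^σ_ℓ(μ) = c·(ℓk+μ) + σ Ω(ℓk+μ)` with `c = (Nm/‖k‖³) k`. -/
noncomputable def wfun (N : ℝ) (m n : ℤ) (σ : ℝ) (ℓ : ℤ) (μ : ℝ × ℝ) : ℝ :=
  let k : ℝ × ℝ := ((m : ℝ), (n : ℝ))
  let K : ℝ := Real.sqrt ((m : ℝ) ^ 2 + (n : ℝ) ^ 2)
  let c : ℝ × ℝ := (N * (m : ℝ) / K ^ 3) • k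
  c.1 * ((ℓ : ℝ) • k + μ).1 + c.2 * ((ℓ : ℝ) • k + μ).2 + σ * Om N ((ℓ : ℝ) • k + μ)

theorem Om_abs_le (N : ℝ) (hN : 0 < N) (v : ℝ × ℝ) : |Om N v| ≤ N := by
  unfold Om
  split_ifs with h
  · simpa using hN.le
  · rw [abs_div, abs_mul, abs_of_pos hN, abs_of_nonneg (Real.sqrt_nonneg _)]
    apply div_le_of_le_mul₀ (Real.sqrt_nonneg _) hN.le
    apply mul_le_mul_of_nonneg_left _ hN.le
    apply Real.abs_le_sqrt
    nlinarith [sq_nonneg v.2]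

theorem Om_k (N : ℝ) (m n : ℤ) (hm : 0 < m) :
    Om N ((m : ℝ), (n : ℝ)) = N * m / Real.sqrt ((m : ℝ) ^ 2 + (n : ℝ) ^ 2) := by
  unfold Om
  rw [if_neg]
  intro h
  have h1 := congrArg Prod.fst h
  have : (0 : ℝ) < m := by exact_mod_cast hm
  simp at h1
  omega

theorem wfun_sub (N : ℝ) (m n : ℤ) (hm : 0 < m) (σ : ℝ) (a b : ℤ) (μ : ℝ × ℝ) :
    wfun N m n σ a μ - wfun N m n σ b μ
      = ((a : ℝ) - b) * Om N ((m : ℝ), (n : ℝ))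
        + σ * Om N ((a : ℝ) • ((m : ℝ), (n : ℝ)) + μ)
        - σ * Om N ((b : ℝ) • ((m : ℝ), (n : ℝ)) + μ) := by
  have hm' : (0 : ℝ) < m := by exact_mod_cast hm
  have hpos : (0 : ℝ) < (m : ℝ) ^ 2 + (n : ℝ) ^ 2 := by positivity
  rw [Om_k N m n hm]
  simp only [wfun, Prod.smul_fst, Prod.smul_snd, Prod.fst_add, Prod.snd_add, smul_eq_mul]
  have hK := Real.sqrt_pos.mpr hpos
  have hsq := Real.sq_sqrt hpos.le
  set K := Real.sqrt ((m : ℝ) ^ 2 + (n : ℝ) ^ 2) with hKdef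
  have key : N * m / K ^ 3 * ((m : ℝ) ^ 2 + (n : ℝ) ^ 2) = N * m / K := by
    rw [← hsq]
    field_simp
  linear_combination ((a : ℝ) - b) * key

/-- the identities (a), (b) for the eigenvalue differences and
(c) the uniform lower bound `≥ 1` for large `|ℓ|` on the resonant set. -/
theorem eigenvalue_differences (N : ℝ) (hN : 0 < N) (m n : ℤ)
    (hm : 0 < m) (hn : 0 < n) :
    let k : ℝ × ℝ := ((m : ℝ), (n : ℝ))
    (∀ μ : ℝ × ℝ, ∀ ℓ : ℤ,
        wfun N m n (-1) ℓ μ - wfun N m n (-1) 1 μ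
          = ((ℓ : ℝ) - 1) * Om N k - Om N ((ℓ : ℝ) • k + μ) + Om N (k + μ)) ∧
    (∀ μ ∈ Rk N m n, ∀ ℓ : ℤ,
        wfun N m n 1 ℓ μ - wfun N m n 1 0 μ
          = ((ℓ : ℝ) - 1) * Om N k + Om N ((ℓ : ℝ) • k + μ) + Om N (k + μ)) ∧
    (∃ ℓ₀ : ℕ, ∀ μ ∈ Rk N m n, ∀ ℓ : ℤ, (ℓ₀ : ℤ) ≤ |ℓ| →
        1 ≤ |wfun N m n 1 ℓ μ - wfun N m n 1 0 μ| ∧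
        1 ≤ |wfun N m n (-1) ℓ μ - wfun N m n (-1) 1 μ|) := by
  intro k
  have hm' : (0 : ℝ) < m := by exact_mod_cast hm
  have hA : ∀ μ : ℝ × ℝ, ∀ ℓ : ℤ,
        wfun N m n (-1) ℓ μ - wfun N m n (-1) 1 μ
          = ((ℓ : ℝ) - 1) * Om N k - Om N ((ℓ : ℝ) • k + μ) + Om N (k + μ) := by
    intro μ ℓ
    rw [wfun_sub N m n hm, Int.cast_one, one_smul]
    ring
  have hB : ∀ μ ∈ Rk N m n, ∀ ℓ : ℤ,
        wfun N m n 1 ℓ μ - wfun N m n 1 0 μ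
          = ((ℓ : ℝ) - 1) * Om N k + Om N ((ℓ : ℝ) • k + μ) + Om N (k + μ) := by
    intro μ hμ ℓ
    have hr : Om N k - Om N (k + μ) = Om N μ := by
      rcases hμ with h | h
      · have h0 : μ = 0 := h
        subst h0
        simp [Om]
      · exact h.2
    rw [wfun_sub N m n hm, Int.cast_zero, zero_smul, zero_add]
    linear_combination hr
  refine ⟨hA, hB, ?_⟩
  have hk : 0 < Om N k := by
    have : Om N k = _ := Om_k N m n hm
    rw [this]
    positivity
  obtain ⟨L, hL⟩ := exists_nat_ge ((1 + 2 * N) / Om N k + 1)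
  have hL' : 1 + 2 * N ≤ ((L : ℝ) - 1) * Om N k := by
    rw [← div_le_iff₀ hk]
    linarith
  refine ⟨L, fun μ hμ ℓ hℓ => ?_⟩
  have hℓ' : (L : ℝ) ≤ |(ℓ : ℝ)| := by exact_mod_cast hℓ
  have h1 : 1 + 2 * N ≤ |((ℓ : ℝ) - 1) * Om N k| := by
    rw [abs_mul, abs_of_pos hk]
    refine hL'.trans (mul_le_mul_of_nonneg_right ?_ hk.le)
    have := abs_sub_abs_le_abs_sub (ℓ : ℝ) 1
    rw [abs_one] at this
    linarith
  have ha := abs_le.mp (Om_abs_le N hN ((ℓ : ℝ) • k + μ))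
  have hb := abs_le.mp (Om_abs_le N hN (k + μ))
  rw [hA, hB μ hμ]
  constructor
  · rcases le_abs.mp h1 with h | h
    · exact le_abs.mpr (Or.inl (by linarith))
    · exact le_abs.mpr (Or.inr (by linarith))
  · rcases le_abs.mp h1 with h | h
    · exact le_abs.mpr (Or.inl (by linarith))
    · exact le_abs.mpr (Or.inr (by linarith))
end

section
/- Let N>0, fix integers m>0, n>0, set k:=(m,n)∈ℝ², c:=(N·m/‖k‖³)·k, and for ℓ∈ℤ, σ∈{+,−}, μ∈ℝ² let w^σ_ℓ(μ):=c·(ℓk+μ)+σ·Ω(ℓk+μ). Then there exists a set D⊆R_k which is discrete (every point of D has an open neighborhood in ℝ² containing no other point of D) such that for every μ∈R_k∖D there exists α>0 with: |w⁺_ℓ(μ) − w⁺_0(μ)| ≥ α for every ℓ∈ℤ with ℓ≠0, and |w⁻_ℓ(μ) − w⁻_1(μ)| ≥ α for every ℓ∈ℤ with ℓ≠1. -/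
/-- Elimination of three square roots `A, B, C` from the resonance equation. -/
def elimF {R : Type*} [CommRing R] (a b g k d l A2 B2 C2 : R) : R :=
  let α1 := (1 - l) * d * b * g
  let α2 := l * d * a * g
  let α3 := - (g * k)
  let β0 := - (d * a * b)
  let β1 := l * k * b
  let β2 := (1 - l) * k * a
  let p0 := α1 ^ 2 * A2 + α2 ^ 2 * B2 + α3 ^ 2 * A2 * B2
    - C2 * (β0 ^ 2 + β1 ^ 2 * A2 + β2 ^ 2 * B2)
  let p1 := 2 * α2 * α3 * B2 - C2 * (2 * β0 * β1)
  let p2 := 2 * α1 * α3 * A2 - C2 * (2 * β0 * β2)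
  let p3 := 2 * α1 * α2 - C2 * (2 * β1 * β2)
  let q0 := p0 ^ 2 + p1 ^ 2 * A2 - B2 * (p2 ^ 2 + p3 ^ 2 * A2)
  let q1 := 2 * p0 * p1 - 2 * B2 * p2 * p3
  q0 ^ 2 - A2 * q1 ^ 2

theorem elimF_zero (a b g k d l A B C : ℝ)
    (h : (g * A - C * a) * (b * d - B * k) = l * ((b * A - B * a) * (g * d - C * k))) :
    elimF a b g k d l (A ^ 2) (B ^ 2) (C ^ 2) = 0 := by
  simp only [elimF]
  set α1 := (1 - l) * d * b * g with hα1
  set α2 := l * d * a * g with hα2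
  set α3 := - (g * k) with hα3
  set β0 := - (d * a * b) with hβ0
  set β1 := l * k * b with hβ1
  set β2 := (1 - l) * k * a with hβ2
  have hE : (α1 * A + α2 * B + α3 * A * B) + (β0 + β1 * A + β2 * B) * C = 0 := by
    rw [hα1, hα2, hα3, hβ0, hβ1, hβ2]
    linear_combination h
  clear_value α1 α2 α3 β0 β1 β2
  set p0 := α1 ^ 2 * A ^ 2 + α2 ^ 2 * B ^ 2 + α3 ^ 2 * A ^ 2 * B ^ 2
    - C ^ 2 * (β0 ^ 2 + β1 ^ 2 * A ^ 2 + β2 ^ 2 * B ^ 2) with hp0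
  set p1 := 2 * α2 * α3 * B ^ 2 - C ^ 2 * (2 * β0 * β1) with hp1
  set p2 := 2 * α1 * α3 * A ^ 2 - C ^ 2 * (2 * β0 * β2) with hp2
  set p3 := 2 * α1 * α2 - C ^ 2 * (2 * β1 * β2) with hp3
  have h1 : p0 + p1 * A + p2 * B + p3 * A * B = 0 := by
    rw [hp0, hp1, hp2, hp3]
    linear_combination
      ((α1 * A + α2 * B + α3 * A * B) - (β0 + β1 * A + β2 * B) * C) * hE
  clear_value p0 p1 p2 p3
  have h2 : (p0 ^ 2 + p1 ^ 2 * A ^ 2 - B ^ 2 * (p2 ^ 2 + p3 ^ 2 * A ^ 2))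
      + (2 * p0 * p1 - 2 * B ^ 2 * p2 * p3) * A = 0 := by
    linear_combination (p0 + p1 * A - (p2 * B + p3 * A * B)) * h1
  linear_combination ((p0 ^ 2 + p1 ^ 2 * A ^ 2 - B ^ 2 * (p2 ^ 2 + p3 ^ 2 * A ^ 2))
      - (2 * p0 * p1 - 2 * B ^ 2 * p2 * p3) * A) * h2

theorem elimF_at_zero (k d l : ℝ) (hd : d ^ 2 = 1 - k ^ 2) :
    elimF 0 k (k * l) k d l 1 (1 - k ^ 2) (1 - (k * l) ^ 2)
      = (k ^ 4 * l ^ 4 * (l ^ 2 - 1) * (l - 1) * (l - 3 + 4 * k ^ 2) * k ^ 4) ^ 2 := by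
  have hk : k ^ 2 = 1 - d ^ 2 := by linarith
  rw [← hd]
  have key : (((1 - l) * d * k * (k * l)) ^ 2 + (k * l * k) ^ 2 * d ^ 2
      - (1 - (k * l) ^ 2) * (l * k * k) ^ 2) ^ 2
      - d ^ 2 * (2 * ((1 - l) * d * k * (k * l)) * (- (k * l * k))) ^ 2
      = k ^ 4 * l ^ 4 * (l ^ 2 - 1) * (l - 1) * (l - 3 + 4 * k ^ 2) * k ^ 4 := by
    have e1 : (d * l) ^ 2 - (1 - (k * l) ^ 2) = l ^ 2 - 1 := by
      linear_combination l ^ 2 * hd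
    have e2 : (d * (2 - l)) ^ 2 - (1 - (k * l) ^ 2) = (l - 1) * (l - 3 + 4 * k ^ 2) := by
      linear_combination (2 - l) ^ 2 * hd
    have : k ^ 4 * l ^ 4 * (l ^ 2 - 1) * (l - 1) * (l - 3 + 4 * k ^ 2) * k ^ 4
      = k ^ 8 * l ^ 4 * ((l ^ 2 - 1) * ((l - 1) * (l - 3 + 4 * k ^ 2))) := by ring
    rw [this, ← e1, ← e2]
    ring
  rw [← key]
  simp only [elimF]
  ring

theorem elimF_at_k (k d : ℝ) (hd : d ^ 2 = 1 - k ^ 2) :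
    elimF k 0 (- (2 * k)) k d (-1) (1 - k ^ 2) 1 (1 - (2 * k) ^ 2)
      = (48 * k ^ 8 * (1 - 4 * k ^ 2)) ^ 2 := by
  rw [← hd]
  have key : ((2 * d * k ^ 2 ) ^ 2 + (2 * k * k) ^ 2 * d ^ 2
      - (1 - (2 * k) ^ 2) * (2 * k * k) ^ 2) ^ 2
      - d ^ 2 * (2 * (2 * d * k * k) * (2 * k * k)) ^ 2
      = - (48 * k ^ 8 * (1 - 4 * k ^ 2)) := by
    have e1 : (2 * d) ^ 2 - (1 - (2 * k) ^ 2) = 3 := by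
      linear_combination 4 * hd
    have : - (48 * k ^ 8 * (1 - 4 * k ^ 2)) = - (16 * k ^ 8 * (1 - 4 * k ^ 2)) * 3 := by ring
    rw [this, ← e1]
    ring
  rw [← neg_sq (48 * k ^ 8 * (1 - 4 * k ^ 2)), ← key]
  simp only [elimF]
  ring

theorem root_finite (k d l : ℝ) (hk : k ≠ 0) (hd : d ^ 2 = 1 - k ^ 2) (h4 : 4 * k ^ 2 ≠ 1)
    (hl0 : l ≠ 0) (hl1 : l ≠ 1) (hl : l - 3 + 4 * k ^ 2 ≠ 0) :
    {a : ℝ | ∃ A B C : ℝ, A ^ 2 = 1 - a ^ 2 ∧ B ^ 2 = 1 - (k - a) ^ 2 ∧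
      C ^ 2 = 1 - (k * l - a) ^ 2 ∧
      ((k * l - a) * A - C * a) * ((k - a) * d - B * k)
        = l * (((k - a) * A - B * a) * ((k * l - a) * d - C * k))}.Finite := by
  let P : Polynomial ℝ := elimF Polynomial.X (Polynomial.C k - Polynomial.X)
    (Polynomial.C (k * l) - Polynomial.X) (Polynomial.C k) (Polynomial.C d) (Polynomial.C l)
    (1 - Polynomial.X ^ 2) (1 - (Polynomial.C k - Polynomial.X) ^ 2)
    (1 - (Polynomial.C (k * l) - Polynomial.X) ^ 2)
  have hP : ∀ a, P.eval a = elimF a (k - a) (k * l - a) k d l (1 - a ^ 2) (1 - (k - a) ^ 2)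
      (1 - (k * l - a) ^ 2) := by
    intro a
    simp only [P, elimF, Polynomial.eval_add, Polynomial.eval_sub, Polynomial.eval_mul,
      Polynomial.eval_pow, Polynomial.eval_neg, Polynomial.eval_C, Polynomial.eval_X,
      Polynomial.eval_one, Polynomial.eval_ofNat]
  have hP0 : P ≠ 0 := by
    intro h0
    by_cases hm : l = -1
    · have h := hP k
      rw [h0, hm] at h
      have e := elimF_at_k k d hd
      have e' : elimF k (k - k) (k * (-1) - k) k d (-1) (1 - k ^ 2) (1 - (k - k) ^ 2)
        (1 - (k * (-1) - k) ^ 2) = elimF k 0 (- (2 * k)) k d (-1) (1 - k ^ 2) 1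
          (1 - (2 * k) ^ 2) := by congr 1 <;> ring
      rw [e', e, Polynomial.eval_zero] at h
      have : 48 * k ^ 8 * (1 - 4 * k ^ 2) ≠ 0 :=
        mul_ne_zero (by positivity) (sub_ne_zero.2 h4.symm)
      exact pow_ne_zero 2 this h.symm
    · have h := hP 0
      rw [h0] at h
      have e := elimF_at_zero k d l hd
      have e' : elimF 0 (k - 0) (k * l - 0) k d l (1 - 0 ^ 2) (1 - (k - 0) ^ 2)
        (1 - (k * l - 0) ^ 2) = elimF 0 k (k * l) k d l 1 (1 - k ^ 2) (1 - (k * l) ^ 2) := by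
        congr 1 <;> ring
      rw [e', e, Polynomial.eval_zero] at h
      have h1 : l ^ 2 - 1 ≠ 0 := by
        have : l ^ 2 - 1 = (l - 1) * (l - -1) := by ring
        rw [this]
        exact mul_ne_zero (sub_ne_zero.2 hl1) (sub_ne_zero.2 hm)
      have h2 : l - 1 ≠ 0 := sub_ne_zero.2 hl1
      have : k ^ 4 * l ^ 4 * (l ^ 2 - 1) * (l - 1) * (l - 3 + 4 * k ^ 2) * k ^ 4 ≠ 0 := by
        simp [hk, hl0, h1, h2, hl]
      exact pow_ne_zero 2 this h.symm
  refine (Polynomial.finite_setOfPred_isRoot hP0).subset ?_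
  rintro a ⟨A, B, C, hA, hB, hC, h⟩
  show P.eval a = 0
  rw [hP, ← hA, ← hB, ← hC]
  exact elimF_zero _ _ _ _ _ _ _ _ _ h

/-- The normalised dispersion relation. -/
noncomputable def fdir (v : ℝ × ℝ) : ℝ := v.1 / Real.sqrt (v.1 ^ 2 + v.2 ^ 2)

theorem Om_eq (N : ℝ) (v : ℝ × ℝ) : Om N v = N * fdir v := by
  unfold Om fdir
  split_ifs with h
  · simp [h]
  · ring

theorem fdir_abs (v : ℝ × ℝ) : |fdir v| ≤ 1 := by
  unfold fdir
  rw [abs_div, abs_of_nonneg (Real.sqrt_nonneg _)]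
  exact div_le_one_of_le₀ (Real.abs_le_sqrt (by nlinarith [sq_nonneg v.2])) (Real.sqrt_nonneg _)

theorem fdir_polar (v : ℝ × ℝ) (hv : v ≠ 0) : ∃ r A : ℝ, 0 < r ∧ v.1 = r * fdir v ∧
    v.2 = r * A ∧ A ^ 2 = 1 - fdir v ^ 2 := by
  have h : 0 < v.1 ^ 2 + v.2 ^ 2 := by
    by_contra h
    apply hv
    have h1 : v.1 = 0 := by nlinarith [sq_nonneg v.1, sq_nonneg v.2]
    have h2 : v.2 = 0 := by nlinarith [sq_nonneg v.1, sq_nonneg v.2]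
    exact Prod.ext h1 h2
  have hs := Real.sqrt_pos.2 h
  have hq := Real.sq_sqrt h.le
  refine ⟨Real.sqrt (v.1 ^ 2 + v.2 ^ 2), v.2 / Real.sqrt (v.1 ^ 2 + v.2 ^ 2), hs, ?_, ?_, ?_⟩
  · unfold fdir; field_simp
  · field_simp
  · unfold fdir
    rw [div_pow, div_pow, hq]
    field_simp
    ring

/-- Finitely many resonant points with a prescribed finite set of directions. -/
theorem fiber_finite (K k d : ℝ) (hK : 0 < K) (hk : 0 < k) (Z : Set ℝ) (hZ : Z.Finite) :
    {μ : ℝ × ℝ | μ ≠ 0 ∧ (K * k, K * d) + μ ≠ 0 ∧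
      fdir ((K * k, K * d) + μ) = k - fdir μ ∧ d ^ 2 = 1 - k ^ 2 ∧ fdir μ ∈ Z}.Finite := by
  let S : Set ℝ := {1, -1}
  have hS : S.Finite := by simp [S]
  let φ : ℝ × ℝ × ℝ → ℝ × ℝ := fun q =>
    let a := q.1
    let A := q.2.1 * Real.sqrt (1 - a ^ 2)
    let B := q.2.2 * Real.sqrt (1 - (k - a) ^ 2)
    let r := - (K * k * B - K * d * (k - a)) / (a * B - A * (k - a))
    (r * a, r * A)
  refine ((hZ.prod (hS.prod hS)).image φ).subset ?_
  rintro μ ⟨h0, h1, hf, hd, hz⟩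
  obtain ⟨r, A, hr, hx, hy, hA⟩ := fdir_polar μ h0
  obtain ⟨s, B, hs, hx', hy', hB⟩ := fdir_polar _ h1
  rw [hf] at hx' hB
  simp only [Prod.fst_add, Prod.snd_add] at hx' hy'
  set a := fdir μ with ha
  have sgn : ∀ x y : ℝ, x ^ 2 = y → ∃ e ∈ S, e * Real.sqrt y = x := by
    intro x y h
    rw [← h, Real.sqrt_sq_eq_abs]
    rcases abs_cases x with ⟨h, _⟩ | ⟨h, _⟩
    · exact ⟨1, by simp [S], by rw [h]; ring⟩
    · exact ⟨-1, by simp [S], by rw [h]; ring⟩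
  obtain ⟨e1, he1, hA'⟩ := sgn _ _ hA
  obtain ⟨e2, he2, hB'⟩ := sgn _ _ hB
  refine ⟨(a, e1, e2), ⟨hz, he1, he2⟩, ?_⟩
  simp only [φ]
  rw [hA', hB']
  have hdet : a * B - A * (k - a) ≠ 0 := by
    intro hdet
    have hba : (k - a) ^ 2 = a ^ 2 := by
      have : a ^ 2 * (1 - (k - a) ^ 2) = (1 - a ^ 2) * (k - a) ^ 2 := by
        rw [← hA, ← hB]; linear_combination (a * B + A * (k - a)) * hdet
      linarith
    have hka : k = 2 * a := by
      have : k * (k - 2 * a) = 0 := by linear_combination hba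
      rcases mul_eq_zero.1 this with h | h
      · exact absurd h hk.ne'
      · linarith
    have ha0 : 0 < a := by linarith
    have hAB : B = A := by
      have : a * (B - A) = 0 := by rw [hka] at hdet; linear_combination hdet
      rcases mul_eq_zero.1 this with h | h
      · exact absurd h ha0.ne'
      · linarith
    have e1 : K * k = (s - r) * a := by rw [hx] at hx'; rw [hka] at hx' ⊢; linear_combination hx'
    have e2 : K * d = (s - r) * A := by rw [hy, hAB] at hy'; linear_combination hy'
    have e3 : (s - r) ^ 2 = K ^ 2 := by
      have : (K * k) ^ 2 + (K * d) ^ 2 = (s - r) ^ 2 := by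
        rw [e1, e2]; linear_combination (s - r) ^ 2 * hA
      rw [← this]; linear_combination K ^ 2 * hd
    have e4 : K ^ 2 * (k ^ 2 - a ^ 2) = 0 := by
      have : (K * k) ^ 2 = K ^ 2 * a ^ 2 := by rw [e1, ← e3]; ring
      linear_combination this
    rw [hka] at e4
    have : 0 < K ^ 2 * ((2 * a) ^ 2 - a ^ 2) := by
      have : (2 * a) ^ 2 - a ^ 2 = 3 * a ^ 2 := by ring
      rw [this]; positivity
    linarith
  have hr' : - (K * k * B - K * d * (k - a)) / (a * B - A * (k - a)) = r := by
    rw [div_eq_iff hdet]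
    rw [hx] at hx'
    rw [hy] at hy'
    linear_combination (-B) * hx' + (k - a) * hy'
  rw [hr']
  exact Prod.ext hx.symm hy.symm

theorem finite_isolated (D : Set (ℝ × ℝ)) (hD : D.Finite) :
    ∀ p ∈ D, ∃ U : Set (ℝ × ℝ), IsOpen U ∧ p ∈ U ∧ ∀ q ∈ U ∩ D, q = p := by
  intro p _
  refine ⟨(D \ {p})ᶜ, (hD.subset Set.sdiff_subset).isClosed.isOpen_compl, by simp, ?_⟩
  rintro q ⟨h1, h2⟩
  by_contra h
  exact h1 ⟨h2, h⟩

theorem lower_bound (N k σ : ℝ) (hN : 0 < N) (hk : 0 < k) (hσ : |σ| = 1) (u : ℤ → ℝ)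
    (hu : ∀ l, |u l| ≤ 1) (j : ℤ)
    (h : ∀ l : ℤ, l ≠ j → N * (k * (l - j) + σ * (u l - u j)) ≠ 0) :
    ∃ α : ℝ, 0 < α ∧ ∀ l : ℤ, l ≠ j → α ≤ |N * (k * (l - j) + σ * (u l - u j))| := by
  obtain ⟨L, hL⟩ := exists_nat_gt (3 / k)
  let I : Finset ℤ := (Finset.Icc (j - L) (j + L)).erase j
  have hbig : ∀ l : ℤ, l ≠ j → l ∉ I → N ≤ |N * (k * (l - j) + σ * (u l - u j))| := by
    intro l hl hI
    have h1 : (L : ℝ) ≤ |(l : ℝ) - j| := by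
      have : (L : ℤ) ≤ |l - j| := by
        by_contra hc
        apply hI
        simp only [I, Finset.mem_erase, Finset.mem_Icc]
        rw [not_le, abs_lt] at hc
        omega
      exact_mod_cast this
    have h2 : 3 < k * |(l : ℝ) - j| := by
      rw [div_lt_iff₀ hk] at hL
      nlinarith
    have h3 : |σ * (u l - u j)| ≤ 2 := by
      rw [abs_mul, hσ, one_mul]
      have := abs_sub (u l) (u j)
      linarith [hu l, hu j]
    have h4 : |k * ((l : ℝ) - j)| = k * |(l : ℝ) - j| := by rw [abs_mul, abs_of_pos hk]
    have h5 := abs_sub_abs_le_abs_add (k * ((l : ℝ) - j)) (σ * (u l - u j))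
    rw [abs_mul, abs_of_pos hN]
    nlinarith
  have key : ∀ J : Finset ℤ, ∃ α : ℝ, 0 < α ∧ α ≤ N ∧
      ∀ l ∈ J, l ≠ j → α ≤ |N * (k * (l - j) + σ * (u l - u j))| := by
    intro J
    induction J using Finset.induction_on with
    | empty => exact ⟨N, hN, le_rfl, by simp⟩
    | insert x J _ ih =>
      obtain ⟨α, h1, h2, h3⟩ := ih
      by_cases hx : x = j
      · refine ⟨α, h1, h2, fun l hl hlj => ?_⟩
        rcases Finset.mem_insert.1 hl with rfl | hl
        · exact absurd hx hlj
        · exact h3 l hl hlj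
      · refine ⟨min α |N * (k * (x - j) + σ * (u x - u j))|, lt_min h1 (abs_pos.2 (h x hx)),
          (min_le_left _ _).trans h2, fun l hl hlj => ?_⟩
        rcases Finset.mem_insert.1 hl with rfl | hl
        · exact min_le_right _ _
        · exact (min_le_left _ _).trans (h3 l hl hlj)
  obtain ⟨α, h1, h2, h3⟩ := key I
  refine ⟨α, h1, fun l hl => ?_⟩
  by_cases hI : l ∈ I
  · exact h3 l hI hl
  · exact h2.trans (hbig l hl hI)

theorem not_quarter (m n : ℤ) (hm : 0 < m) (h : n ^ 2 = 3 * m ^ 2) : False := by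
  have hp : Prime (3 : ℤ) := Int.prime_three
  have h3 : Irrational (Real.sqrt 3) := by
    have := Nat.Prime.irrational_sqrt (p := 3) (by norm_num)
    exact_mod_cast this
  apply h3
  have hm' : (0 : ℝ) < m := by exact_mod_cast hm
  have hr : (n : ℝ) ^ 2 = 3 * (m : ℝ) ^ 2 := by exact_mod_cast h
  refine ⟨|(n : ℚ)| / m, ?_⟩
  push_cast
  symm
  rw [Real.sqrt_eq_iff_mul_self_eq (by norm_num) (by positivity)]
  rw [div_mul_div_comm, abs_mul_abs_self]
  field_simp
  linarith

theorem bad_finite (K k d : ℝ) (hK : 0 < K) (hk : 0 < k) (hd0 : 0 < d) (hd : d ^ 2 = 1 - k ^ 2)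
    (h4 : 4 * k ^ 2 ≠ 1) :
    {μ : ℝ × ℝ | (μ = 0 ∨ (μ ≠ 0 ∧ k - fdir ((K * k, K * d) + μ) = fdir μ)) ∧
      ((∃ l : ℤ, l ≠ 0 ∧ k * l + (fdir ((l : ℝ) • (K * k, K * d) + μ) - fdir μ) = 0) ∨
       (∃ l : ℤ, l ≠ 1 ∧ k * (l - 1) - (fdir ((l : ℝ) • (K * k, K * d) + μ)
          - fdir ((K * k, K * d) + μ)) = 0))}.Finite := by
  obtain ⟨L, hL⟩ := exists_nat_gt (2 / k)
  rw [div_lt_iff₀ hk] at hL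
  let I : Set ℤ := Set.Icc (-(L : ℤ) - 1) (L + 1)
  have hI : I.Finite := Set.finite_Icc _ _
  let Z : ℤ → Set ℝ := fun l => if l = 0 ∨ l = 1 then {0, k} else
    {a : ℝ | ∃ A B C : ℝ, A ^ 2 = 1 - a ^ 2 ∧ B ^ 2 = 1 - (k - a) ^ 2 ∧
      C ^ 2 = 1 - (k * l - a) ^ 2 ∧
      ((k * l - a) * A - C * a) * ((k - a) * d - B * k)
        = l * (((k - a) * A - B * a) * ((k * l - a) * d - C * k))}
  have hZ : ∀ l, (Z l).Finite := by
    intro l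
    simp only [Z]
    split_ifs with h
    · simp
    · push Not at h
      refine root_finite k d l hk.ne' hd h4 (by exact_mod_cast h.1) (by exact_mod_cast h.2) ?_
      intro hc
      have hk1 : k ^ 2 < 1 := by nlinarith
      have hk0 : 0 < k ^ 2 := by positivity
      have h1 : (l : ℝ) < 3 := by linarith
      have h2 : (-1 : ℝ) < l := by linarith
      have h1' : l < 3 := by exact_mod_cast h1
      have h2' : -1 < l := by exact_mod_cast h2
      have : l = 2 := by omega
      rw [this] at hc
      push_cast at hc
      apply h4
      linarith
  let T : ℤ → Set (ℝ × ℝ) := fun l => {(-(l : ℝ)) • (K * k, K * d)} ∪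
    {μ : ℝ × ℝ | μ ≠ 0 ∧ (K * k, K * d) + μ ≠ 0 ∧
      fdir ((K * k, K * d) + μ) = k - fdir μ ∧ d ^ 2 = 1 - k ^ 2 ∧ fdir μ ∈ Z l}
  have hT : ∀ l, (T l).Finite := fun l =>
    (Set.finite_singleton _).union (fiber_finite K k d hK hk (Z l) (hZ l))
  have hfin : (({0} ∪ {-(K * k, K * d)}) ∪ ⋃ l ∈ I, T l).Finite :=
    ((Set.finite_singleton _).union (Set.finite_singleton _)).union
      (hI.biUnion fun l _ => hT l)
  refine hfin.subset ?_
  rintro μ ⟨hR, hB⟩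
  by_cases h0 : μ = 0
  · left; left; exact h0
  by_cases h1 : (K * k, K * d) + μ = 0
  · left; right; exact (neg_eq_of_add_eq_zero_right h1).symm
  right
  have hR' : fdir ((K * k, K * d) + μ) = k - fdir μ := by
    rcases hR with h | ⟨_, h⟩
    · exact absurd h h0
    · linarith
  have hB' : ∃ l : ℤ, ∃ e : ℝ, (e = 1 ∨ e = -1) ∧
      ((l = 0 ∨ l = 1) → fdir μ = 0 ∨ fdir μ = k) ∧
      e * fdir ((l : ℝ) • (K * k, K * d) + μ) = k * l - fdir μ := by
    rcases hB with ⟨l, hl, h⟩ | ⟨l, hl, h⟩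
    · refine ⟨l, -1, Or.inr rfl, ?_, by linarith⟩
      rintro (rfl | rfl)
      · exact absurd rfl hl
      · right
        simp only [Int.cast_one, one_smul] at h
        rw [hR'] at h
        linarith
    · refine ⟨l, 1, Or.inl rfl, ?_, by rw [hR'] at h; linarith⟩
      rintro (rfl | rfl)
      · left
        simp only [Int.cast_zero, zero_smul, zero_add] at h
        rw [hR'] at h
        linarith
      · exact absurd rfl hl
  obtain ⟨l, e, he, h01, h⟩ := hB'
  have hlI : l ∈ I := by
    have a1 := abs_le.1 (fdir_abs μ)
    have a2 := abs_le.1 (fdir_abs ((l : ℝ) • (K * k, K * d) + μ))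
    have b1 : k * l ≤ 2 := by rcases he with rfl | rfl <;> linarith
    have b2 : -2 ≤ k * l := by rcases he with rfl | rfl <;> linarith
    have c1 : (l : ℝ) < L := by
      by_contra hc
      nlinarith
    have c2 : -(L : ℝ) < l := by
      by_contra hc
      nlinarith
    have c1' : l < L := by exact_mod_cast c1
    have c2' : -(L : ℤ) < l := by exact_mod_cast c2
    simp only [I, Set.mem_Icc]
    omega
  refine Set.mem_biUnion hlI ?_
  by_cases h2 : (l : ℝ) • (K * k, K * d) + μ = 0
  · left
    rw [Set.mem_singleton_iff, neg_smul]
    exact (neg_eq_of_add_eq_zero_right h2).symm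
  right
  refine ⟨h0, h1, hR', hd, ?_⟩
  simp only [Z]
  split_ifs with hl
  · exact h01 hl
  obtain ⟨r, A, hr, hx, hy, hA⟩ := fdir_polar μ h0
  obtain ⟨s, B, hs, hx', hy', hB1⟩ := fdir_polar _ h1
  obtain ⟨t, C, ht, hx'', hy'', hC⟩ := fdir_polar _ h2
  have he2 : e ^ 2 = 1 := by rcases he with rfl | rfl <;> norm_num
  rw [hR'] at hx' hB1
  set a := fdir μ
  set f := fdir ((l : ℝ) • (K * k, K * d) + μ)
  have hf : f = e * (k * l - a) := by rw [← h]; linear_combination (-f) * he2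
  refine ⟨A, B, e * C, hA, hB1, ?_, ?_⟩
  · rw [← h]; linear_combination e ^ 2 * hC + he2
  simp only [Prod.fst_add, Prod.snd_add, Prod.smul_fst, Prod.smul_snd, smul_eq_mul] at hx' hy' hx'' hy''
  rw [hf] at hx''
  have hne : r * s * (t * e) * K ≠ 0 := by
    have : e ≠ 0 := by rintro rfl; norm_num at he2
    positivity
  apply mul_left_cancel₀ hne
  have x1 : t * e * (k * l - a) = l * (K * k) + μ.1 := by rw [hx'']; ring
  have x2 : t * e * (e * C) = l * (K * d) + μ.2 := by rw [hy'']; linear_combination t * C * he2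
  calc r * s * (t * e) * K * (((k * l - a) * A - e * C * a) * ((k - a) * d - B * k))
      = ((t * e * (k * l - a)) * (r * A) - (t * e * (e * C)) * (r * a)) *
        ((s * (k - a)) * (K * d) - (s * B) * (K * k)) := by ring
    _ = l * (((s * (k - a)) * (r * A) - (s * B) * (r * a)) *
        ((t * e * (k * l - a)) * (K * d) - (t * e * (e * C)) * (K * k))) := by
        rw [x1, x2, ← hx', ← hy', ← hx, ← hy]; ring
    _ = _ := by ring

/-- Proposition 2.6: there is a discrete subset `D ⊆ R_k` such that for
every `μ ∈ R_k ∖ D` the double eigenvalue is separated by some `α(μ) > 0` from all the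
other eigenvalues. -/
theorem double_eigenvalue_isolated (N : ℝ) (hN : 0 < N) (m n : ℤ)
    (hm : 0 < m) (hn : 0 < n) :
    ∃ D : Set (ℝ × ℝ), D ⊆ Rk N m n ∧
      (∀ p ∈ D, ∃ U : Set (ℝ × ℝ), IsOpen U ∧ p ∈ U ∧ ∀ q ∈ U ∩ D, q = p) ∧
      (∀ μ ∈ Rk N m n \ D, ∃ α : ℝ, 0 < α ∧
        (∀ ℓ : ℤ, ℓ ≠ 0 → α ≤ |wfun N m n 1 ℓ μ - wfun N m n 1 0 μ|) ∧
        (∀ ℓ : ℤ, ℓ ≠ 1 → α ≤ |wfun N m n (-1) ℓ μ - wfun N m n (-1) 1 μ|)) := by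
  have hm' : (0 : ℝ) < m := by exact_mod_cast hm
  have hn' : (0 : ℝ) < n := by exact_mod_cast hn
  have hpos : (0 : ℝ) < (m : ℝ) ^ 2 + (n : ℝ) ^ 2 := by positivity
  obtain ⟨K, hKdef⟩ : ∃ K, K = Real.sqrt ((m : ℝ) ^ 2 + (n : ℝ) ^ 2) := ⟨_, rfl⟩
  have hK : 0 < K := by rw [hKdef]; exact Real.sqrt_pos.2 hpos
  have hK2 : K ^ 2 = (m : ℝ) ^ 2 + (n : ℝ) ^ 2 := by rw [hKdef]; exact Real.sq_sqrt hpos.le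
  obtain ⟨k, hkdef⟩ : ∃ k, k = (m : ℝ) / K := ⟨_, rfl⟩
  obtain ⟨d, hddef⟩ : ∃ d, d = (n : ℝ) / K := ⟨_, rfl⟩
  have hk : 0 < k := by rw [hkdef]; positivity
  have hd0 : 0 < d := by rw [hddef]; positivity
  have hmk : (m : ℝ) = K * k := by rw [hkdef]; field_simp
  have hnd : (n : ℝ) = K * d := by rw [hddef]; field_simp
  have hd : d ^ 2 = 1 - k ^ 2 := by
    rw [hmk, hnd] at hK2
    have : K ^ 2 * (d ^ 2 - (1 - k ^ 2)) = 0 := by linear_combination -hK2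
    rcases mul_eq_zero.1 this with h | h
    · exact absurd h (by positivity)
    · linarith
  have h4 : 4 * k ^ 2 ≠ 1 := by
    intro h
    apply not_quarter m n hm
    have : (n : ℝ) ^ 2 = 3 * (m : ℝ) ^ 2 := by
      rw [hnd, hmk]; linear_combination K ^ 2 * hd - K ^ 2 * h
    exact_mod_cast this
  have hfk : fdir ((m : ℝ), (n : ℝ)) = k := by
    simp only [fdir]; rw [← hKdef, hkdef]
  have hw : ∀ (σ : ℝ) (l j : ℤ) (μ : ℝ × ℝ), wfun N m n σ l μ - wfun N m n σ j μ
      = N * (k * (l - j) + σ * (fdir ((l : ℝ) • ((m : ℝ), (n : ℝ)) + μ)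
        - fdir ((j : ℝ) • ((m : ℝ), (n : ℝ)) + μ))) := by
    intro σ l j μ
    simp only [wfun, Om_eq, ← hKdef, Prod.fst_add, Prod.snd_add, Prod.smul_fst, Prod.smul_snd,
      smul_eq_mul]
    have : N * (m : ℝ) / K ^ 3 * ((m : ℝ) ^ 2 + (n : ℝ) ^ 2) = N * k := by
      rw [← hK2, hkdef]; field_simp
    linear_combination ((l : ℝ) - j) * this
  let D : Set (ℝ × ℝ) := {μ | μ ∈ Rk N m n ∧
    ((∃ l : ℤ, l ≠ 0 ∧ wfun N m n 1 l μ - wfun N m n 1 0 μ = 0) ∨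
     (∃ l : ℤ, l ≠ 1 ∧ wfun N m n (-1) l μ - wfun N m n (-1) 1 μ = 0))}
  have hDfin : D.Finite := by
    refine (bad_finite K k d hK hk hd0 hd h4).subset ?_
    rintro μ ⟨hR, hB⟩
    rw [← hmk, ← hnd]
    refine ⟨?_, ?_⟩
    · rcases hR with h | ⟨h0, h⟩
      · exact Or.inl h
      · refine Or.inr ⟨h0, ?_⟩
        rw [Om_eq, Om_eq, Om_eq, hfk] at h
        apply mul_left_cancel₀ hN.ne'
        linear_combination h
    · rcases hB with ⟨l, hl, h⟩ | ⟨l, hl, h⟩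
      · refine Or.inl ⟨l, hl, ?_⟩
        rw [hw] at h
        have := (mul_eq_zero.1 h).resolve_left hN.ne'
        simp only [Int.cast_zero, zero_smul, zero_add] at this
        linear_combination this
      · refine Or.inr ⟨l, hl, ?_⟩
        rw [hw] at h
        have := (mul_eq_zero.1 h).resolve_left hN.ne'
        simp only [Int.cast_one, one_smul] at this
        linear_combination this
  refine ⟨D, fun μ h => h.1, finite_isolated D hDfin, ?_⟩
  rintro μ ⟨hR, hD⟩
  obtain ⟨α, hα, hα'⟩ := lower_bound N k 1 hN hk (by norm_num)
    (fun l : ℤ => fdir ((l : ℝ) • ((m : ℝ), (n : ℝ)) + μ)) (fun l => fdir_abs _) 0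
    (fun l hl h => hD ⟨hR, Or.inl ⟨l, hl, by rw [hw]; exact h⟩⟩)
  obtain ⟨β, hβ, hβ'⟩ := lower_bound N k (-1) hN hk (by norm_num)
    (fun l : ℤ => fdir ((l : ℝ) • ((m : ℝ), (n : ℝ)) + μ)) (fun l => fdir_abs _) 1
    (fun l hl h => hD ⟨hR, Or.inr ⟨l, hl, by rw [hw]; exact h⟩⟩)
  refine ⟨min α β, lt_min hα hβ, fun l hl => ?_, fun l hl => ?_⟩
  · rw [hw]; exact (min_le_left _ _).trans (hα' l hl)
  · rw [hw]; exact (min_le_right _ _).trans (hβ' l hl)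
end

section
/- Let N>0, fix integers m>0, n>0, set k:=(m,n)∈ℝ², and define F(x,y):=(m+x)/√((m+x)²+(n+y)²) + x/√(x²+y²) − m/√(m²+n²) and 𝚎(μ) := (k^⊥·μ)²·(‖k+μ‖−‖k‖)·(‖k‖+‖μ‖)·(‖k+μ‖+‖k‖−‖μ‖)² / (16·N²·‖μ‖²·‖k+μ‖²·‖k‖²), where k^⊥:=(n,−m). Let 0<δ<n and let φ₊:(0,δ)→ℝ and φ₋:(−δ,0)→ℝ satisfy F(φ₊(y),y)=0 for all y∈(0,δ) and F(φ₋(y),y)=0 for all y∈(−δ,0). Define μ(τ):=(φ₊(n·τ), n·τ) for 0<τ<δ/n and μ(τ):=(φ₋(n·τ), n·τ) for −δ/n<τ<0. Then lim_{τ→0, τ≠0} 𝚎(μ(τ))/τ = m²·n²/(4·N²·(m²+n²)). -/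
/-- The instability coefficient `𝚎(μ)` of Theorem 2.7, with `k = (m,n)`, `k^⊥ = (n,−m)`. -/
noncomputable def efun (N : ℝ) (m n : ℤ) (μ : ℝ × ℝ) : ℝ :=
  let nk : ℝ := Real.sqrt ((m : ℝ) ^ 2 + (n : ℝ) ^ 2)
  let nμ : ℝ := Real.sqrt (μ.1 ^ 2 + μ.2 ^ 2)
  let nkμ : ℝ := Real.sqrt (((m : ℝ) + μ.1) ^ 2 + ((n : ℝ) + μ.2) ^ 2)
  ((n : ℝ) * μ.1 - (m : ℝ) * μ.2) ^ 2 * (nkμ - nk) * (nk + nμ) * (nkμ + nk - nμ) ^ 2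
    / (16 * N ^ 2 * nμ ^ 2 * nkμ ^ 2 * nk ^ 2)

lemma le_sq_aux {a b : ℝ} (h : a ^ 2 ≤ b ^ 2) (hb : 0 ≤ b) : a ≤ b :=
  (le_abs_self a).trans (abs_le_of_sq_le_sq h hb)

lemma mono_aux (a a' b : ℝ) (hb : b ≠ 0) (h : a ≤ a') :
    a / Real.sqrt (a ^ 2 + b ^ 2) ≤ a' / Real.sqrt (a' ^ 2 + b ^ 2) := by
  have hb2 : 0 < b ^ 2 := by positivity
  have h1 : 0 < Real.sqrt (a ^ 2 + b ^ 2) := Real.sqrt_pos.2 (by positivity)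
  have h2 : 0 < Real.sqrt (a' ^ 2 + b ^ 2) := Real.sqrt_pos.2 (by positivity)
  have s1 := Real.sq_sqrt (show 0 ≤ a ^ 2 + b ^ 2 by positivity)
  have s2 := Real.sq_sqrt (show 0 ≤ a' ^ 2 + b ^ 2 by positivity)
  rw [div_le_div_iff₀ h1 h2]
  generalize Real.sqrt (a ^ 2 + b ^ 2) = p at *
  generalize Real.sqrt (a' ^ 2 + b ^ 2) = q at *
  rcases le_total 0 a with ha | ha
  · have ha' : 0 ≤ a' := ha.trans h
    refine le_sq_aux ?_ (by positivity)
    rw [mul_pow, mul_pow, s1, s2]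
    nlinarith [mul_le_mul_of_nonneg_right (pow_le_pow_left₀ ha h 2) hb2.le]
  · rcases le_total 0 a' with ha' | ha'
    · nlinarith [mul_nonneg ha' h1.le, mul_nonneg (neg_nonneg.2 ha) h2.le]
    · have : (-a') * p ≤ (-a) * q := by
        refine le_sq_aux ?_ (mul_nonneg (neg_nonneg.2 ha) h2.le)
        rw [mul_pow, mul_pow, s1, s2]
        have := pow_le_pow_left₀ (neg_nonneg.2 ha') (neg_le_neg h) 2
        nlinarith [mul_le_mul_of_nonneg_right this hb2.le]
      linarith

lemma s_bound (m n : ℤ) (x y : ℝ) (hny : (n : ℝ) + y ≠ 0) (h : Ffun m n x y = 0) :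
    |x / Real.sqrt (x ^ 2 + y ^ 2)| ≤
      |(m : ℝ) / Real.sqrt ((m : ℝ) ^ 2 + (n : ℝ) ^ 2)
        - (m : ℝ) / Real.sqrt ((m : ℝ) ^ 2 + ((n : ℝ) + y) ^ 2)| := by
  unfold Ffun at h
  rcases le_total 0 x with hx | hx
  · have := mono_aux m (m + x) (n + y) hny (by linarith)
    have h0 : 0 ≤ x / Real.sqrt (x ^ 2 + y ^ 2) := by positivity
    rw [abs_of_nonneg h0]
    refine le_trans ?_ (le_abs_self _)
    linarith
  · have := mono_aux (m + x) m (n + y) hny (by linarith)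
    have h0 : x / Real.sqrt (x ^ 2 + y ^ 2) ≤ 0 :=
      div_nonpos_of_nonpos_of_nonneg hx (Real.sqrt_nonneg _)
    rw [abs_of_nonpos h0]
    refine le_trans ?_ (neg_le_abs _)
    linarith

lemma t_bound (x y s : ℝ) (hy : y ≠ 0) (hs : |x / Real.sqrt (x ^ 2 + y ^ 2)| ≤ s)
    (hs2 : s ≤ 1 / 2) : |x / y| ≤ 2 * s := by
  have hy2 : 0 < y ^ 2 := by positivity
  have h1 : 0 < Real.sqrt (x ^ 2 + y ^ 2) := Real.sqrt_pos.2 (by positivity)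
  have s1 := Real.sq_sqrt (show 0 ≤ x ^ 2 + y ^ 2 by positivity)
  have hs0 : 0 ≤ s := (abs_nonneg _).trans hs
  rw [abs_div, abs_of_pos h1, div_le_iff₀ h1] at hs
  have hsq : x ^ 2 ≤ s ^ 2 * (x ^ 2 + y ^ 2) := by
    have := pow_le_pow_left₀ (abs_nonneg x) hs 2
    rwa [sq_abs, mul_pow, s1] at this
  have hs4 : s ^ 2 ≤ 1 / 4 := by nlinarith
  rw [abs_div, div_le_iff₀ (abs_pos.2 hy)]
  refine le_sq_aux ?_ (by positivity)
  rw [sq_abs, mul_pow, sq_abs]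
  have hxy : x ^ 2 ≤ y ^ 2 := by nlinarith [sq_nonneg x]
  nlinarith [mul_le_mul_of_nonneg_left hxy (sq_nonneg s), mul_nonneg (sq_nonneg s) (sq_nonneg y)]

noncomputable def Gfun (N m n : ℝ) (p : ℝ × ℝ) : ℝ :=
  n * ((n * p.1 - m) ^ 2 * (2 * m * p.1 + 2 * n + p.2 * (p.1 ^ 2 + 1)) *
    (Real.sqrt (m ^ 2 + n ^ 2) + Real.sqrt ((p.1 * p.2) ^ 2 + p.2 ^ 2)) *
    (Real.sqrt ((m + p.1 * p.2) ^ 2 + (n + p.2) ^ 2) + Real.sqrt (m ^ 2 + n ^ 2)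
      - Real.sqrt ((p.1 * p.2) ^ 2 + p.2 ^ 2)) ^ 2) /
   ((p.1 ^ 2 + 1) * (Real.sqrt ((m + p.1 * p.2) ^ 2 + (n + p.2) ^ 2) + Real.sqrt (m ^ 2 + n ^ 2)) *
    (16 * N ^ 2 * Real.sqrt ((m + p.1 * p.2) ^ 2 + (n + p.2) ^ 2) ^ 2
      * Real.sqrt (m ^ 2 + n ^ 2) ^ 2))

lemma G_cont (N m n : ℝ) (hN : 0 < N) (hm : 0 < m) (hn : 0 < n) :
    Filter.Tendsto (Gfun N m n) (nhds (0, 0)) (nhds (m ^ 2 * n ^ 2 / (4 * N ^ 2 * (m ^ 2 + n ^ 2)))) := by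
  have hK : 0 < Real.sqrt (m ^ 2 + n ^ 2) := Real.sqrt_pos.2 (by positivity)
  have s1 := Real.sq_sqrt (show 0 ≤ m ^ 2 + n ^ 2 by positivity)
  have hv : Gfun N m n (0, 0) = m ^ 2 * n ^ 2 / (4 * N ^ 2 * (m ^ 2 + n ^ 2)) := by
    simp only [Gfun]
    simp only [mul_zero, add_zero, zero_add, zero_sub, sub_zero, ne_eq, OfNat.ofNat_ne_zero,
      not_false_eq_true, zero_pow, Real.sqrt_zero]
    rw [← s1, Real.sqrt_sq hK.le]
    generalize Real.sqrt (m ^ 2 + n ^ 2) = K at *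
    field_simp
    ring
  rw [← hv]
  have : ContinuousAt (Gfun N m n) (0, 0) := by
    unfold Gfun
    refine ContinuousAt.div (by fun_prop) (by fun_prop) ?_
    simp only [mul_zero, add_zero]
    positivity
  exact this

lemma e_eq (N : ℝ) (hN : 0 < N) (m n : ℤ) (hm : 0 < m) (hn : 0 < n) (x τ : ℝ) (hτ : τ ≠ 0)
    (hny : (n : ℝ) + n * τ ≠ 0) :
    efun N m n (x, n * τ) / τ = Gfun N m n (x / (n * τ), n * τ) := by
  have hm0 : (0 : ℝ) < m := by exact_mod_cast hm
  have hn0 : (0 : ℝ) < n := by exact_mod_cast hn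
  obtain ⟨y, hy⟩ : ∃ y : ℝ, y = n * τ := ⟨_, rfl⟩
  have hτy : τ = y / n := by rw [hy]; field_simp
  have hy0 : y ≠ 0 := by rw [hy]; positivity
  rw [← hy] at hny ⊢
  rw [hτy]
  have hxy : x / y * y = x := by field_simp
  simp only [efun, Gfun, hxy]
  have hK : 0 < Real.sqrt ((m : ℝ) ^ 2 + (n : ℝ) ^ 2) := Real.sqrt_pos.2 (by positivity)
  have hA : 0 < Real.sqrt (((m : ℝ) + x) ^ 2 + ((n : ℝ) + y) ^ 2) := Real.sqrt_pos.2 (by positivity)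
  have hB : 0 < Real.sqrt (x ^ 2 + y ^ 2) := Real.sqrt_pos.2 (by positivity)
  have sK := Real.sq_sqrt (show 0 ≤ (m : ℝ) ^ 2 + (n : ℝ) ^ 2 by positivity)
  have sA := Real.sq_sqrt (show 0 ≤ ((m : ℝ) + x) ^ 2 + ((n : ℝ) + y) ^ 2 by positivity)
  have sB := Real.sq_sqrt (show 0 ≤ x ^ 2 + y ^ 2 by positivity)
  generalize Real.sqrt ((m : ℝ) ^ 2 + (n : ℝ) ^ 2) = K at *
  generalize Real.sqrt (((m : ℝ) + x) ^ 2 + ((n : ℝ) + y) ^ 2) = A at *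
  generalize Real.sqrt (x ^ 2 + y ^ 2) = B at *
  have e1 : A - K = y * (2 * m * (x / y) + 2 * n + y * ((x / y) ^ 2 + 1)) / (A + K) := by
    rw [eq_div_iff (by positivity)]
    have : y * (2 * m * (x / y) + 2 * n + y * ((x / y) ^ 2 + 1)) =
      2 * m * x + 2 * n * y + x ^ 2 + y ^ 2 := by field_simp; ring
    rw [this]; linear_combination sA - sK
  have e2 : B ^ 2 = y ^ 2 * ((x / y) ^ 2 + 1) := by rw [sB]; field_simp
  have e3 : (n : ℝ) * x - m * y = y * (n * (x / y) - m) := by field_simp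
  rw [e1, e2, e3]
  generalize x / y = t
  have : t ^ 2 + 1 ≠ 0 := by positivity
  have : A + K ≠ 0 := by positivity
  field_simp


/-- small-Floquet asymptotics of the instability coefficient along the
resonant branches: `𝚎(μ(τ))/τ → m²n²/(4N²‖k‖²)` as `τ → 0`, `τ ≠ 0`. -/
theorem e_small_floquet (N : ℝ) (hN : 0 < N) (m n : ℤ) (hm : 0 < m) (hn : 0 < n)
    (δ : ℝ) (hδ0 : 0 < δ) (hδn : δ < (n : ℝ))
    (φp φm : ℝ → ℝ)
    (hp : ∀ y : ℝ, 0 < y → y < δ → Ffun m n (φp y) y = 0)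
    (hm' : ∀ y : ℝ, -δ < y → y < 0 → Ffun m n (φm y) y = 0) :
    Filter.Tendsto
      (fun τ : ℝ =>
        efun N m n
          (if 0 < τ then (φp ((n : ℝ) * τ), (n : ℝ) * τ)
            else (φm ((n : ℝ) * τ), (n : ℝ) * τ)) / τ)
      (nhdsWithin 0 {(0 : ℝ)}ᶜ)
      (nhds ((m : ℝ) ^ 2 * (n : ℝ) ^ 2 / (4 * N ^ 2 * ((m : ℝ) ^ 2 + (n : ℝ) ^ 2)))) := by
  have hm0 : (0 : ℝ) < m := by exact_mod_cast hm
  have hn0 : (0 : ℝ) < n := by exact_mod_cast hn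
  set X : ℝ → ℝ := fun τ => if 0 < τ then φp (n * τ) else φm (n * τ) with hX
  set D : ℝ → ℝ := fun τ => |(m : ℝ) / Real.sqrt ((m : ℝ) ^ 2 + (n : ℝ) ^ 2)
        - (m : ℝ) / Real.sqrt ((m : ℝ) ^ 2 + ((n : ℝ) + n * τ) ^ 2)| with hD
  have hDc : Filter.Tendsto D (nhdsWithin 0 {(0 : ℝ)}ᶜ) (nhds 0) := by
    have h0 : D 0 = 0 := by simp [hD]
    have : ContinuousAt D 0 := by
      refine ContinuousAt.abs (ContinuousAt.sub continuousAt_const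
        (ContinuousAt.div continuousAt_const (by fun_prop) ?_))
      simp only [mul_zero, add_zero]
      positivity
    have h := this.tendsto
    rw [h0] at h
    exact h.mono_left nhdsWithin_le_nhds
  have hsmall : ∀ᶠ τ : ℝ in nhdsWithin (0 : ℝ) {(0 : ℝ)}ᶜ, τ ≠ 0 ∧ |n * τ| < δ ∧ D τ ≤ 1 / 2 := by
    refine (eventually_mem_nhdsWithin).and (Filter.Eventually.and ?_ ?_)
    · have : ContinuousAt (fun τ : ℝ => |(n : ℝ) * τ|) 0 := by fun_prop
      have h := this.tendsto
      simp only [mul_zero, abs_zero] at h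
      exact (h.mono_left nhdsWithin_le_nhds).eventually (gt_mem_nhds hδ0)
    · exact hDc.eventually (ge_mem_nhds (by norm_num))
  have key : ∀ᶠ τ : ℝ in nhdsWithin (0 : ℝ) {(0 : ℝ)}ᶜ, (n : ℝ) + n * τ ≠ 0 ∧ τ ≠ 0 ∧
      |X τ / (n * τ)| ≤ 2 * D τ := by
    filter_upwards [hsmall] with τ ⟨h0, h1, h2⟩
    obtain ⟨h1a, h1b⟩ := abs_lt.1 h1
    have hny : (n : ℝ) + n * τ ≠ 0 := by linarith
    refine ⟨hny, h0, t_bound _ _ _ (by positivity) (s_bound m n _ _ hny ?_) h2⟩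
    rcases lt_or_gt_of_ne h0 with hneg | hpos
    · simp only [hX, if_neg (not_lt.2 hneg.le)]
      exact hm' _ h1a (mul_neg_of_pos_of_neg hn0 hneg)
    · simp only [hX, if_pos hpos]
      exact hp _ (mul_pos hn0 hpos) h1b
  have ht : Filter.Tendsto (fun τ => X τ / (n * τ)) (nhdsWithin 0 {(0 : ℝ)}ᶜ) (nhds 0) := by
    refine squeeze_zero_norm' (a := fun τ => 2 * D τ) ?_ (by simpa using hDc.const_mul 2)
    filter_upwards [key] with τ h
    exact h.2.2
  have hy : Filter.Tendsto (fun τ : ℝ => (n : ℝ) * τ) (nhdsWithin 0 {(0 : ℝ)}ᶜ) (nhds 0) := by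
    have : ContinuousAt (fun τ : ℝ => (n : ℝ) * τ) 0 := by fun_prop
    have h := this.tendsto
    simp only [mul_zero] at h
    exact h.mono_left nhdsWithin_le_nhds
  refine ((G_cont N m n hN hm0 hn0).comp (ht.prodMk_nhds hy)).congr' ?_
  filter_upwards [key] with τ ⟨h1, h2, _⟩
  have hif : (if 0 < τ then (φp ((n : ℝ) * τ), (n : ℝ) * τ)
            else (φm ((n : ℝ) * τ), (n : ℝ) * τ)) = (X τ, (n : ℝ) * τ) := by
    simp only [hX]; split_ifs <;> rfl
  rw [hif, e_eq N hN m n hm hn _ _ h2 h1]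
  rfl
end

section
/- Let N>0, fix integers m>0, n>0, set k:=(m,n)∈ℝ², and define F(x,y):=(m+x)/√((m+x)²+(n+y)²) + x/√(x²+y²) − m/√(m²+n²) and 𝚎(μ) := (k^⊥·μ)²·(‖k+μ‖−‖k‖)·(‖k‖+‖μ‖)·(‖k+μ‖+‖k‖−‖μ‖)² / (16·N²·‖μ‖²·‖k+μ‖²·‖k‖²), where k^⊥:=(n,−m). Let Y>0 and let φ:(Y,∞)→ℝ satisfy F(φ(y),y)=0 for all y>Y. Then lim_{τ→+∞} 𝚎((φ(τ),τ)) = m²·(n−√(3m²+4n²))²·(3m²+2n²+n·√(3m²+4n²))² / (256·N²·(m²+n²)³). -/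
/-- high-Floquet limit of the instability coefficient along the upper
resonant branch (Parametric Subharmonic Instability regime). -/
theorem e_high_floquet (N : ℝ) (hN : 0 < N) (m n : ℤ) (hm : 0 < m) (hn : 0 < n)
    (Y : ℝ) (hY : 0 < Y) (φ : ℝ → ℝ)
    (hφ : ∀ y : ℝ, Y < y → Ffun m n (φ y) y = 0) :
    Filter.Tendsto (fun τ : ℝ => efun N m n (φ τ, τ)) Filter.atTop
      (nhds ((m : ℝ) ^ 2 * ((n : ℝ) - Real.sqrt (3 * (m : ℝ) ^ 2 + 4 * (n : ℝ) ^ 2)) ^ 2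
        * (3 * (m : ℝ) ^ 2 + 2 * (n : ℝ) ^ 2
            + (n : ℝ) * Real.sqrt (3 * (m : ℝ) ^ 2 + 4 * (n : ℝ) ^ 2)) ^ 2
        / (256 * N ^ 2 * ((m : ℝ) ^ 2 + (n : ℝ) ^ 2) ^ 3))) := by
  
  have hm' : (0:ℝ) < m := by exact_mod_cast hm
  have hn' : (0:ℝ) < n := by exact_mod_cast hn
  unfold efun
  unfold Ffun at hφ
  dsimp only
  generalize (m:ℝ) = a at *
  generalize (n:ℝ) = b at *
  set K := Real.sqrt (a ^ 2 + b ^ 2) with hK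
  have hKp : 0 < K := Real.sqrt_pos.mpr (by positivity)
  have hK2 : K ^ 2 = a ^ 2 + b ^ 2 := Real.sq_sqrt (by positivity)
  set s := Real.sqrt (3 * a ^ 2 + 4 * b ^ 2) with hs
  have hsp : 0 < s := Real.sqrt_pos.mpr (by positivity)
  have hs2 : s ^ 2 = 3 * a ^ 2 + 4 * b ^ 2 := Real.sq_sqrt (by positivity)
  set r : ℝ → ℝ := fun τ => Real.sqrt (φ τ ^ 2 + τ ^ 2) with hr
  set q : ℝ → ℝ := fun τ => Real.sqrt ((a + φ τ) ^ 2 + (b + τ) ^ 2) with hq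
  have hr2 : ∀ τ, r τ ^ 2 = φ τ ^ 2 + τ ^ 2 := fun τ => Real.sq_sqrt (by positivity)
  have hq2 : ∀ τ, q τ ^ 2 = (a + φ τ) ^ 2 + (b + τ) ^ 2 := fun τ => Real.sq_sqrt (by positivity)
  have hrp : ∀ τ, 0 < τ → 0 < r τ := fun τ h => Real.sqrt_pos.mpr (by positivity)
  have hqp : ∀ τ, 0 < τ → 0 < q τ := fun τ h => Real.sqrt_pos.mpr (by positivity)
  have hrt : ∀ τ, 0 < τ → τ ≤ r τ := fun τ h => Real.le_sqrt_of_sq_le (by nlinarith [sq_nonneg (φ τ)])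
  have hrtop : Filter.Tendsto r Filter.atTop Filter.atTop := by
    refine Filter.tendsto_atTop_mono' _ ?_ Filter.tendsto_id
    filter_upwards [Filter.eventually_gt_atTop 0] with τ h using hrt τ h
  have hw : Filter.Tendsto (fun τ => (r τ)⁻¹) Filter.atTop (nhds 0) :=
    tendsto_inv_atTop_zero.comp hrtop
  -- the ratio of the two norms tends to one
  have hp : Filter.Tendsto (fun τ => q τ / r τ) Filter.atTop (nhds 1) := by
    rw [tendsto_iff_dist_tendsto_zero]
    have hb : Filter.Tendsto (fun τ => (2 * (a + b) + K ^ 2 * (r τ)⁻¹) * (r τ)⁻¹)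
        Filter.atTop (nhds 0) := by
      have := ((hw.const_mul (K^2)).const_add (2 * (a + b))).mul hw
      simpa using this
    refine squeeze_zero' (Filter.Eventually.of_forall fun _ => dist_nonneg) ?_ hb
    filter_upwards [Filter.eventually_gt_atTop 0] with τ h
    have h1 := hrp τ h
    have h2 := hqp τ h
    have h3 := hr2 τ
    have h4 := hq2 τ
    have hx : |φ τ| ≤ r τ := abs_le_of_sq_le_sq (by nlinarith) h1.le
    have hx' := abs_le.mp hx
    have hy := hrt τ h
    rw [Real.dist_eq]
    have e1 : q τ / r τ - 1 = (q τ - r τ) / r τ := by field_simp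
    have e2 : (2 * (a + b) + K ^ 2 * (r τ)⁻¹) * (r τ)⁻¹
        = ((2 * (a + b) * r τ + K ^ 2) / r τ) / r τ := by field_simp
    rw [e1, e2, abs_div, abs_of_pos h1]
    gcongr
    rw [le_div_iff₀ h1]
    have h5 : |q τ - r τ| * (q τ + r τ) = |K ^ 2 + 2 * (a * φ τ + b * τ)| := by
      rw [← abs_of_pos (add_pos h2 h1), ← abs_mul]
      congr 1
      linear_combination h4 - h3 - hK2
    have h6 : |K ^ 2 + 2 * (a * φ τ + b * τ)| ≤ 2 * (a + b) * r τ + K ^ 2 := by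
      rw [abs_le]
      constructor <;> nlinarith [mul_le_mul_of_nonneg_left hx'.1 hm'.le,
        mul_le_mul_of_nonneg_left hx'.2 hm'.le, mul_le_mul_of_nonneg_left hy hn'.le,
        mul_pos hn' h, mul_pos hn' h1]
    nlinarith [mul_nonneg (abs_nonneg (q τ - r τ)) h2.le]
  have hu : Filter.Tendsto (fun τ => φ τ / r τ) Filter.atTop (nhds (a / (2 * K))) := by
    have h0 : Filter.Tendsto (fun τ => (a / K * (q τ / r τ) - a * (r τ)⁻¹) / (q τ / r τ + 1))
        Filter.atTop (nhds ((a / K * 1 - a * 0) / (1 + 1))) :=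
      ((hp.const_mul _).sub (hw.const_mul _)).div (hp.add_const 1) (by norm_num)
    have e : (a / K * 1 - a * 0) / (1 + 1) = a / (2 * K) := by field_simp; ring
    rw [e] at h0
    refine h0.congr' ?_
    filter_upwards [Filter.eventually_gt_atTop 0, Filter.eventually_gt_atTop Y] with τ h h'
    have h1 := hrp τ h
    have h2 := hqp τ h
    have h3 : (a + φ τ) / q τ + φ τ / r τ - a / K = 0 := hφ τ h'
    have h4 : a / K = (a + φ τ) / q τ + φ τ / r τ := by linarith
    rw [h4]
    field_simp
    ring
  have hv : Filter.Tendsto (fun τ => τ / r τ) Filter.atTop (nhds (s / (2 * K))) := by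
    have h0 := ((hu.pow 2).const_sub 1).sqrt
    have e : Real.sqrt (1 - (a / (2 * K)) ^ 2) = s / (2 * K) := by
      rw [Real.sqrt_eq_iff_mul_self_eq_of_pos (by positivity)]
      field_simp
      nlinarith
    rw [e] at h0
    refine h0.congr' ?_
    filter_upwards [Filter.eventually_gt_atTop 0] with τ h
    have h1 := hrp τ h
    have h3 := hr2 τ
    rw [Real.sqrt_eq_iff_mul_self_eq_of_pos (by positivity)]
    field_simp
    nlinarith
  have hd : Filter.Tendsto (fun τ => (K ^ 2 * (r τ)⁻¹ + 2 * (a * (φ τ / r τ) + b * (τ / r τ)))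
      / (q τ / r τ + 1)) Filter.atTop
      (nhds ((K ^ 2 * 0 + 2 * (a * (a / (2 * K)) + b * (s / (2 * K)))) / (1 + 1))) :=
    ((hw.const_mul _).add (((hu.const_mul a).add (hv.const_mul b)).const_mul 2)).div
      (hp.add_const 1) (by norm_num)
  have hfin := (((((hu.const_mul b).sub (hv.const_mul a)).pow 2).mul
    (hp.sub (hw.const_mul K))).mul ((hw.const_mul K).add_const 1)).mul
    ((hd.const_add K).pow 2)
  have hfin2 := hfin.div ((hp.pow 2).const_mul (16 * N ^ 2 * K ^ 2)) (by positivity)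
  have hlim : a ^ 2 * (b - s) ^ 2 * (3 * a ^ 2 + 2 * b ^ 2 + b * s) ^ 2
      / (256 * N ^ 2 * (a ^ 2 + b ^ 2) ^ 3) =
      (b * (a / (2 * K)) - a * (s / (2 * K))) ^ 2 * (1 - K * 0) * (K * 0 + 1) *
      (K + (K ^ 2 * 0 + 2 * (a * (a / (2 * K)) + b * (s / (2 * K)))) / (1 + 1)) ^ 2 /
      (16 * N ^ 2 * K ^ 2 * 1 ^ 2) := by
    have e : 3 * a ^ 2 + 2 * b ^ 2 + b * s = 2 * K ^ 2 + a ^ 2 + b * s := by rw [hK2]; ring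
    rw [e, ← hK2]
    field_simp
    ring
  rw [hlim]
  refine hfin2.congr' ?_
  filter_upwards [Filter.eventually_gt_atTop 0] with τ h
  have h1 := hrp τ h
  have h2 := hqp τ h
  have hdd : (K ^ 2 * (r τ)⁻¹ + 2 * (a * (φ τ / r τ) + b * (τ / r τ))) / (q τ / r τ + 1)
      = q τ - r τ := by
    rw [div_eq_iff (by positivity)]
    field_simp
    linear_combination hK2 + hr2 τ - hq2 τ
  simp only [Pi.div_apply, hdd]
  change _ = (b * φ τ - a * τ) ^ 2 * (q τ - K) * (K + r τ) * (q τ + K - r τ) ^ 2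
    / (16 * N ^ 2 * r τ ^ 2 * q τ ^ 2 * K ^ 2)
  generalize r τ = R at *
  generalize q τ = Q at *
  field_simp
  ring
end

section
/- Let N>0, ε∈ℝ, fix reals m>0, n>0, set k:=(m,n)∈ℝ², and let μ=(μ₁,μ₂)∈ℝ² with μ≠0 and k+μ≠0. Set p:=n·μ₁−m·μ₂ (=k^⊥·μ). Define the complex 2×2 matrices A := [[−i·p/(N·‖k‖), i·p/‖k+μ‖²], [0, −i·p/(N·‖k‖) + i·‖k‖·p/(N·‖k+μ‖²)]] and J₀ := [[0, i·μ₁],[i·μ₁, 0]], and the vectors u := (1/√2)·(N, ‖k+μ‖)ᵀ ∈ ℂ² and v := (1/√2)·(N, ‖μ‖)ᵀ ∈ ℂ². Then ⟨J₀·((ε/2)·A)·u, v⟩ = (ε/4)·p·μ₁·(‖k+μ‖−‖k‖)·(‖k+μ‖+‖k‖+‖μ‖)/(‖k‖·‖k+μ‖), where ⟨z,w⟩ := z₁·conj(w₁)+z₂·conj(w₂). -/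
/-- Lemma 4.5, eq. (eq:B1mk): explicit value of the entanglement
coefficient `𝔅₁[−k](0,k;−,−) = ⟨J₀·(ε/2)A·f_k⁻, f_0⁻⟩`. -/
theorem entanglement_B1mk (N ε : ℝ) (hN : 0 < N) (m n : ℝ) (hm : 0 < m) (hn : 0 < n)
    (μ1 μ2 : ℝ) (hμ : (μ1, μ2) ≠ ((0 : ℝ), (0 : ℝ)))
    (hkμ : (m + μ1, n + μ2) ≠ ((0 : ℝ), (0 : ℝ))) :
    let p : ℝ := n * μ1 - m * μ2
    let nk : ℝ := Real.sqrt (m ^ 2 + n ^ 2)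
    let nμ : ℝ := Real.sqrt (μ1 ^ 2 + μ2 ^ 2)
    let nkμ : ℝ := Real.sqrt ((m + μ1) ^ 2 + (n + μ2) ^ 2)
    let A : Matrix (Fin 2) (Fin 2) ℂ :=
      !![-Complex.I * ((p / (N * nk) : ℝ) : ℂ), Complex.I * ((p / nkμ ^ 2 : ℝ) : ℂ);
         0, -Complex.I * ((p / (N * nk) : ℝ) : ℂ)
              + Complex.I * ((nk * p / (N * nkμ ^ 2) : ℝ) : ℂ)]
    let J0 : Matrix (Fin 2) (Fin 2) ℂ :=
      !![0, Complex.I * ((μ1 : ℝ) : ℂ); Complex.I * ((μ1 : ℝ) : ℂ), 0]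
    let u : Fin 2 → ℂ := (1 / Real.sqrt 2 : ℝ) • ![((N : ℝ) : ℂ), ((nkμ : ℝ) : ℂ)]
    let v : Fin 2 → ℂ := (1 / Real.sqrt 2 : ℝ) • ![((N : ℝ) : ℂ), ((nμ : ℝ) : ℂ)]
    let ip : (Fin 2 → ℂ) → (Fin 2 → ℂ) → ℂ := fun z w =>
      z 0 * (starRingEnd ℂ) (w 0) + z 1 * (starRingEnd ℂ) (w 1)
    ip ((J0 * (((ε / 2 : ℝ) : ℂ) • A)).mulVec u) v
      = ((ε / 4 * p * μ1 * (nkμ - nk) * (nkμ + nk + nμ) / (nk * nkμ) : ℝ) : ℂ) := by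
  intro p nk nμ nkμ A J0 u v ip
  have hnk : nk ≠ 0 := by
    have : 0 < nk := Real.sqrt_pos.mpr (by positivity)
    exact this.ne'
  have hnkμ : nkμ ≠ 0 := by
    intro h
    have h2 := (Real.sqrt_eq_zero (by positivity)).mp h
    apply hkμ
    have h3 : m + μ1 = 0 := by nlinarith [sq_nonneg (m + μ1), sq_nonneg (n + μ2)]
    have h4 : n + μ2 = 0 := by nlinarith [sq_nonneg (m + μ1), sq_nonneg (n + μ2)]
    rw [h3, h4]
  have hs : (1 / Real.sqrt 2) * (1 / Real.sqrt 2) = 1 / 2 := by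
    rw [div_mul_div_comm, Real.mul_self_sqrt (by norm_num)]; norm_num
  have hN' : N ≠ 0 := hN.ne'
  clear_value p nk nμ nkμ
  generalize hsd : (1 / Real.sqrt 2 : ℝ) = s at *
  have hsC : (s : ℂ) * s = 1 / 2 := by
    have := congrArg (fun x : ℝ => (x : ℂ)) hs
    push_cast at this
    exact this
  have cN : (N : ℂ) ≠ 0 := by exact_mod_cast hN'
  have ck : (nk : ℂ) ≠ 0 := by exact_mod_cast hnk
  have ckμ : (nkμ : ℂ) ≠ 0 := by exact_mod_cast hnkμ
  have key : ip ((J0 * (((ε / 2 : ℝ) : ℂ) • A)).mulVec u) v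
      = (Complex.I * Complex.I) * ((s : ℂ) * s) * (ε / 2 * μ1 * p) *
        ((-(1 / (N * nk)) + nk / (N * nkμ ^ 2)) * nkμ * N
          + (-(1 / (N * nk)) * N + 1 / nkμ ^ 2 * nkμ) * nμ) := by
    simp only [Complex.I_mul_I, ← hsd]
    simp [ip, J0, A, u, v]
    ring_nf
    simp only [Complex.I_sq]
    ring
  rw [key, hsC, Complex.I_mul_I]
  push_cast
  field_simp
  ring
end
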